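/- The natural ring homomorphism ρ : R → Hom_R(H^c_I(ω_R), H^c_I(ω_R)), sending r ∈ R to the endomorphism given by multiplication by r, is surjective if and only if the socle Hom_R(𝕜, H^{d−c}_𝔪(H^c_I(ω_R))) is a 1-dimensional 𝕜-vector space. -/

import Mathlib

open CategoryTheory Opposite

set_option synthInstance.maxHeartbeats 1000000
set_option maxHeartbeats 1000000

noncomputable section

/-- The grade of an ideal: the maximal length of a regular sequence contained in it. -/
def idealGrade {A : Type} [CommRing A] (J : Ideal A) : ℕ∞ :=
  sSup {c : ℕ∞ | ∃ rs : List A, (∀ r ∈ rs, r ∈ J) ∧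
    RingTheory.Sequence.IsRegular A rs ∧ (rs.length : ℕ∞) = c}

/-- A canonical module of a `d`-dimensional local ring `A`: a finitely generated module `ω`
with `Ext_A^i(𝕜, ω) = 0` for `i ≠ d` and `Ext_A^d(𝕜, ω)` a one-dimensional `𝕜`-vector space
(equivalently, isomorphic to `𝕜` as an `A`-module), where `𝕜` is the residue field. -/
def IsCanonicalModule (A : Type) [CommRing A] [IsLocalRing A] (d : ℕ)
    (ω : ModuleCat A) : Prop :=
  Module.Finite A ω ∧
  (∀ i : ℕ, i ≠ d → Subsingleton
    (((Ext A (ModuleCat A) i).obj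
      (op (ModuleCat.of A (IsLocalRing.ResidueField A)))).obj ω)) ∧
  Nonempty ((((Ext A (ModuleCat A) d).obj
      (op (ModuleCat.of A (IsLocalRing.ResidueField A)))).obj ω)
    ≃ₗ[A] IsLocalRing.ResidueField A)

namespace OpHomology

variable {R : Type} [CommRing R] (K : ChainComplex (ModuleCat.{0} R)ᵒᵖ ℕ) (n : ℕ)

lemma pOpcycles_unop_injective : Function.Injective (K.pOpcycles n).unop := by
  rw [← ModuleCat.mono_iff_injective]; infer_instance

lemma homologyι_unop_surjective : Function.Surjective (K.homologyι n).unop := by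
  rw [← ModuleCat.epi_iff_surjective]; infer_instance

lemma exists_pOpcycles_unop (z : (K.X n).unop) (hz : (K.d (n + 1) n).unop z = 0) :
    ∃ c : (K.opcycles n).unop, (K.pOpcycles n).unop c = z := by
  have h := (ShortComplex.exact_of_g_is_cokernel
    (ShortComplex.mk (K.d (n + 1) n) (K.pOpcycles n) (by simp))
    (K.opcyclesIsCokernel (n + 1) n (by simp))).unop
  rw [ShortComplex.moduleCat_exact_iff] at h
  exact h z hz

lemma d_pOpcycles_unop (c : (K.opcycles n).unop) :
    (K.d (n + 1) n).unop ((K.pOpcycles n).unop c) = 0 := by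
  rw [← ModuleCat.comp_apply, ← unop_comp, K.d_pOpcycles]; simp

lemma homologyι_unop_eq_zero_iff (m : ℕ) (hm : (ComplexShape.down ℕ).next n = m)
    (c : (K.opcycles n).unop) :
    (K.homologyι n).unop c = 0 ↔
      ∃ b : (K.X m).unop, (K.d n m).unop b = (K.pOpcycles n).unop c := by
  have h := (ShortComplex.exact_of_f_is_kernel
    (ShortComplex.mk (K.homologyι n) (K.fromOpcycles n m) (by simp))
    (K.homologyIsKernel n m hm)).unop
  rw [ShortComplex.moduleCat_exact_iff] at h
  constructor
  · intro hc
    obtain ⟨b, hb⟩ : ∃ b : (K.X m).unop, (K.fromOpcycles n m).unop b = c := h c hc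
    refine ⟨b, ?_⟩
    rw [← hb, ← ModuleCat.comp_apply, ← unop_comp, K.p_fromOpcycles]
  · rintro ⟨b, hb⟩
    have : c = (K.fromOpcycles n m).unop b := by
      apply pOpcycles_unop_injective K n
      rw [← hb, ← ModuleCat.comp_apply, ← unop_comp, K.p_fromOpcycles]
    rw [this, ← ModuleCat.comp_apply, ← unop_comp, K.homologyι_comp_fromOpcycles]
    simp

end OpHomology

namespace CategoryTheory.ProjectiveResolution

variable {C : Type*} [Category* C] [Abelian C] [HasExt C]
  {X Y : C} (P : ProjectiveResolution X)

lemma extMk_eq_zero_iff_next {n : ℕ} (f : P.complex.X n ⟶ Y) (m : ℕ) (hm : n + 1 = m)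
    (hf : P.complex.d m n ≫ f = 0) (p : ℕ) (hp : (ComplexShape.down ℕ).next n = p) :
    P.extMk f m hm hf = 0 ↔ ∃ (g : P.complex.X p ⟶ Y), P.complex.d n p ≫ g = f := by
  obtain _ | n := n
  · obtain rfl : 0 = p := by simpa using hp
    simp only [← P.extEquivCohomologyClass.apply_eq_iff_eq,
      extEquivCohomologyClass_extMk, extEquivCohomologyClass_zero,
      CochainComplex.HomComplex.CohomologyClass.mk_eq_zero_iff]
    rw [CochainComplex.HomComplex.Cocycle.toSingleMk_mem_coboundaries_iff _ _ _ _ _ 1 (by lia)]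
    have h0 : Limits.IsZero (P.cochainComplex.X 1) :=
      P.cochainComplex.isZero_of_isStrictlyLE 0 1 (by lia)
    constructor
    · rintro ⟨g, hg⟩
      rw [h0.eq_of_src g 0, Limits.comp_zero] at hg
      refine ⟨0, ?_⟩
      rw [← cancel_epi (P.cochainComplexXIso (-(0 : ℕ)) 0 rfl).hom, ← hg]
      simp
    · rintro ⟨g, hg⟩
      refine ⟨0, ?_⟩
      rw [← hg, P.complex.shape _ _ (by simp)]
      simp
  · obtain rfl : n = p := by simpa using hp
    exact P.extMk_eq_zero_iff f m hm hf n rfl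

end CategoryTheory.ProjectiveResolution

namespace ExtComparison

variable {R : Type} [CommRing R]

/-- The additive functor whose left derived functors define `Ext R (ModuleCat R)`. -/
abbrev homRightOp (N : ModuleCat.{0} R) : ModuleCat.{0} R ⥤ (ModuleCat.{0} R)ᵒᵖ :=
  ((linearYoneda R (ModuleCat R)).obj N).rightOp

/-- The complex of homomorphisms from a chain complex to `N`, in the opposite category. -/
abbrev homComplex (N : ModuleCat.{0} R) (K : ChainComplex (ModuleCat.{0} R) ℕ) :
    ChainComplex (ModuleCat.{0} R)ᵒᵖ ℕ :=
  ((homRightOp N).mapHomologicalComplex (ComplexShape.down ℕ)).obj K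

/-- The module of degree `n` cocycles with values in `N`. -/
abbrev Cocyc (N : ModuleCat.{0} R) (K : ChainComplex (ModuleCat.{0} R) ℕ) (n : ℕ) : Type :=
  ((homComplex N K).opcycles n).unop

variable {A : ModuleCat.{0} R} (P : ProjectiveResolution A) (N : ModuleCat.{0} R) (n : ℕ)

/-- The homomorphism underlying a cocycle. -/
def cocycHom (K : ChainComplex (ModuleCat.{0} R) ℕ) : Cocyc N K n →ₗ[R] (K.X n ⟶ N) :=
  ((homComplex N K).pOpcycles n).unop.hom

lemma d_cocycHom (K : ChainComplex (ModuleCat.{0} R) ℕ) (c : Cocyc N K n) :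
    K.d (n + 1) n ≫ cocycHom N n K c = 0 :=
  OpHomology.d_pOpcycles_unop (homComplex N K) n c

/-- The derived-functor `Ext` as the homology of a complex of homomorphisms. -/
def resIso : ((homRightOp N).leftDerived n).obj A ≅ (homComplex N P.complex).homology n :=
  P.isoLeftDerivedObj (homRightOp N) n

/-- The class of a cocycle in the derived-functor `Ext`. -/
def oldClass : Cocyc N P.complex n →ₗ[R] ((Ext R (ModuleCat R) n).obj (op A)).obj N :=
  ((resIso P N n).hom ≫ (homComplex N P.complex).homologyι n).unop.hom

/-- The class of a cocycle in the derived-category `Ext`. -/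
def newClass : Cocyc N P.complex n →ₗ[R] Abelian.Ext A N n where
  toFun c := P.extMk (cocycHom N n _ c) (n + 1) rfl (d_cocycHom N n _ c)
  map_add' c c' := by rw [P.add_extMk]; congr 1; simp
  map_smul' r c := by
    rw [RingHom.id_apply, Abelian.Ext.smul_eq_comp_mk₀, P.extMk_comp_mk₀]; congr 1; simp

lemma newClass_eq (c : Cocyc N P.complex n) (f : P.complex.X n ⟶ N) (h : cocycHom N n _ c = f) :
    newClass P N n c = P.extMk f (n + 1) rfl (h ▸ d_cocycHom N n _ c) := by
  subst h; rfl

lemma oldClass_surjective : Function.Surjective (oldClass P N n) := by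
  intro x
  obtain ⟨c, hc⟩ := OpHomology.homologyι_unop_surjective (homComplex N P.complex) n
    ((resIso P N n).inv.unop x)
  refine ⟨c, ?_⟩
  change (resIso P N n).hom.unop
    (((homComplex N P.complex).homologyι n).unop c) = x
  rw [hc]
  exact ConcreteCategory.congr_hom (resIso P N n).unop.inv_hom_id x

lemma newClass_surjective : Function.Surjective (newClass P N n) := by
  intro x
  obtain ⟨f, hf, rfl⟩ := P.extMk_surjective x (n + 1) rfl
  obtain ⟨c, hc⟩ := OpHomology.exists_pOpcycles_unop (homComplex N P.complex) n f hf
  refine ⟨c, ?_⟩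
  exact newClass_eq P N n c f hc

lemma ker_class : LinearMap.ker (oldClass P N n) = LinearMap.ker (newClass P N n) := by
  ext c
  have h := OpHomology.homologyι_unop_eq_zero_iff (homComplex N P.complex) n _ rfl c
  have h2 := P.extMk_eq_zero_iff_next (cocycHom N n _ c) (n + 1) rfl (d_cocycHom N n _ c) _ rfl
  rw [LinearMap.mem_ker, LinearMap.mem_ker]
  refine Iff.trans ?_ (h.trans (Iff.trans ?_ h2.symm))
  · change (resIso P N n).hom.unop
      (((homComplex N P.complex).homologyι n).unop c) = 0 ↔ _
    exact map_eq_zero_iff (resIso P N n).hom.unop.hom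
      ((ModuleCat.mono_iff_injective (resIso P N n).hom.unop).1 inferInstance)
  · rfl

/-- The comparison between the two definitions of `Ext`, for a given projective resolution. -/
def extEquivOfRes : ((Ext R (ModuleCat R) n).obj (op A)).obj N ≃ₗ[R] Abelian.Ext A N n :=
  ((oldClass P N n).quotKerEquivOfSurjective (oldClass_surjective P N n)).symm ≪≫ₗ
    Submodule.quotEquivOfEq _ _ (ker_class P N n) ≪≫ₗ
      (newClass P N n).quotKerEquivOfSurjective (newClass_surjective P N n)

lemma extEquivOfRes_oldClass (c : Cocyc N P.complex n) :
    extEquivOfRes P N n (oldClass P N n c) = newClass P N n c := by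
  have : ((oldClass P N n).quotKerEquivOfSurjective (oldClass_surjective P N n)).symm
      (oldClass P N n c) = Submodule.Quotient.mk c := by
    rw [LinearEquiv.symm_apply_eq]; rfl
  simp only [extEquivOfRes, LinearEquiv.trans_apply, this]
  rfl

lemma extEquivOfRes_naturality_left {B : ModuleCat.{0} R} (Q : ProjectiveResolution B)
    (f : A ⟶ B) (x : ((Ext R (ModuleCat R) n).obj (op B)).obj N) :
    extEquivOfRes P N n (((Ext R (ModuleCat R) n).map f.op).app N x) =
      (Abelian.Ext.mk₀ f).comp (extEquivOfRes Q N n x) (zero_add n) := by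
  obtain ⟨c, rfl⟩ := oldClass_surjective Q N n x
  let φ : P.complex ⟶ Q.complex := ProjectiveResolution.lift f P Q
  have hφ : φ.f 0 ≫ Q.π.f 0 = P.π.f 0 ≫ ((ChainComplex.single₀ (ModuleCat R)).map f).f 0 := by
    rw [← HomologicalComplex.comp_f, ProjectiveResolution.lift_commutes,
      HomologicalComplex.comp_f]
  let Φ : ProjectiveResolution.Hom P Q f := ⟨φ, hφ⟩
  let ψ := ((homRightOp N).mapHomologicalComplex (ComplexShape.down ℕ)).map φ
  let c' : Cocyc N P.complex n := (HomologicalComplex.opcyclesMap ψ n).unop c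
  have h1 : cocycHom N n _ c' = φ.f n ≫ cocycHom N n _ c :=
    (ConcreteCategory.congr_hom (congrArg Quiver.Hom.unop
      (HomologicalComplex.p_opcyclesMap ψ n)) c)
  have h2 : ((Ext R (ModuleCat R) n).map f.op).app N (oldClass Q N n c) = oldClass P N n c' := by
    have e1 : ((homRightOp N).leftDerived n).map f ≫ (resIso Q N n).hom =
        (resIso P N n).hom ≫ HomologicalComplex.homologyMap ψ n :=
      ProjectiveResolution.isoLeftDerivedObj_hom_naturality f P Q φ
        (by simpa using hφ) (homRightOp N) n
    have e2 := HomologicalComplex.homologyι_naturality ψ n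
    have e3 : ((homRightOp N).leftDerived n).map f ≫ (resIso Q N n).hom ≫
        (homComplex N Q.complex).homologyι n = (resIso P N n).hom ≫
        (homComplex N P.complex).homologyι n ≫ HomologicalComplex.opcyclesMap ψ n := by
      rw [← e2, reassoc_of% e1]
    exact (ConcreteCategory.congr_hom (congrArg Quiver.Hom.unop e3) c)
  rw [h2, extEquivOfRes_oldClass, extEquivOfRes_oldClass]
  refine Eq.trans ?_ (ProjectiveResolution.mk₀_comp_extMk (cocycHom N n _ c) (n + 1) rfl
    (d_cocycHom N n _ c) Φ).symm
  exact newClass_eq P N n c' _ h1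

lemma extEquivOfRes_naturality_right {N' : ModuleCat.{0} R} (g : N ⟶ N')
    (x : ((Ext R (ModuleCat R) n).obj (op A)).obj N) :
    extEquivOfRes P N' n (((Ext R (ModuleCat R) n).obj (op A)).map g x) =
      (extEquivOfRes P N n x).comp (Abelian.Ext.mk₀ g) (add_zero n) := by
  obtain ⟨c, rfl⟩ := oldClass_surjective P N n x
  let α : homRightOp N' ⟶ homRightOp N := NatTrans.rightOp ((linearYoneda R (ModuleCat R)).map g)
  let ψ := (NatTrans.mapHomologicalComplex α (ComplexShape.down ℕ)).app P.complex
  let c' : Cocyc N' P.complex n := (HomologicalComplex.opcyclesMap ψ n).unop c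
  have h1 : cocycHom N' n _ c' = cocycHom N n _ c ≫ g :=
    (ConcreteCategory.congr_hom (congrArg Quiver.Hom.unop
      (HomologicalComplex.p_opcyclesMap ψ n)) c)
  have h2 : ((Ext R (ModuleCat R) n).obj (op A)).map g (oldClass P N n c) =
      oldClass P N' n c' := by
    have e1 : (NatTrans.leftDerived α n).app A ≫ (resIso P N n).hom =
        (resIso P N' n).hom ≫ HomologicalComplex.homologyMap ψ n := by
      rw [← Iso.eq_comp_inv, Category.assoc]
      exact ProjectiveResolution.leftDerived_app_eq α P n
    have e2 := HomologicalComplex.homologyι_naturality ψ n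
    have e3 : (NatTrans.leftDerived α n).app A ≫ (resIso P N n).hom ≫
        (homComplex N P.complex).homologyι n = (resIso P N' n).hom ≫
        (homComplex N' P.complex).homologyι n ≫ HomologicalComplex.opcyclesMap ψ n := by
      rw [← e2, reassoc_of% e1]
    exact (ConcreteCategory.congr_hom (congrArg Quiver.Hom.unop e3) c)
  rw [h2, extEquivOfRes_oldClass, extEquivOfRes_oldClass]
  refine Eq.trans ?_ (P.extMk_comp_mk₀ (cocycHom N n _ c) (n + 1) rfl (d_cocycHom N n _ c) g).symm
  exact newClass_eq P N' n c' _ h1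

/-- The comparison between the derived-functor `Ext` and the derived-category `Ext`. -/
def extEquiv (A N : ModuleCat.{0} R) (n : ℕ) :
    ((Ext R (ModuleCat R) n).obj (op A)).obj N ≃ₗ[R] Abelian.Ext A N n :=
  extEquivOfRes (projectiveResolution A) N n

end ExtComparison

namespace ExtLC

open Abelian

variable {R : Type} [CommRing R]

/-- The cyclic module `R ⧸ a`. -/
abbrev Cyc (a : Ideal R) : ModuleCat.{0} R := ModuleCat.of R (R ⧸ a)

/-- The projection `R ⧸ a ⟶ R ⧸ b` for `a ≤ b`. -/
def quotMap {a b : Ideal R} (h : a ≤ b) : Cyc a ⟶ Cyc b :=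
  ModuleCat.ofHom (Submodule.mapQ a b LinearMap.id h)

lemma quotMap_refl {a : Ideal R} (h : a ≤ a) : quotMap h = 𝟙 (Cyc a) := by
  ext
  rfl

/-- Functoriality of `Ext` in the first variable. -/
def pre {A B : ModuleCat.{0} R} (f : A ⟶ B) (N : ModuleCat.{0} R) (n : ℕ) :
    Ext B N n →ₗ[R] Ext A N n :=
  Ext.precompOfLinear (Ext.mk₀ f) R N (zero_add n)

/-- Functoriality of `Ext` in the second variable. -/
def post (A : ModuleCat.{0} R) {N N' : ModuleCat.{0} R} (g : N ⟶ N') (n : ℕ) :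
    Ext A N n →ₗ[R] Ext A N' n :=
  Ext.postcompOfLinear (Ext.mk₀ g) R A (add_zero n)

section

variable {A B C N N' N'' : ModuleCat.{0} R} {n : ℕ}

lemma pre_apply (f : A ⟶ B) (x : Ext B N n) :
    pre f N n x = (Ext.mk₀ f).comp x (zero_add n) := rfl

lemma post_apply (g : N ⟶ N') (x : Ext A N n) :
    post A g n x = x.comp (Ext.mk₀ g) (add_zero n) := rfl

lemma pre_pre (f : A ⟶ B) (g : B ⟶ C) (x : Ext C N n) :
    pre f N n (pre g N n x) = pre (f ≫ g) N n x := by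
  simp only [pre_apply, Ext.mk₀_comp_mk₀_assoc]

lemma pre_id (x : Ext A N n) : pre (𝟙 A) N n x = x := by
  simp [pre_apply]

lemma post_id (x : Ext A N n) : post A (𝟙 N) n x = x := by
  simp [post_apply]

lemma pre_post (f : A ⟶ B) (g : N ⟶ N') (x : Ext B N n) :
    pre f N' n (post B g n x) = post A g n (pre f N n x) := by
  simp only [post_apply, pre_apply]
  rw [Ext.comp_assoc]
  all_goals simp

lemma pre_comp {p q : ℕ} (f : A ⟶ B) (x : Ext B N n) (y : Ext N N' p) (h : n + p = q) :
    pre f N' q (x.comp y h) = (pre f N n x).comp y h := by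
  simp only [pre_apply]
  rw [Ext.comp_assoc]
  all_goals omega

lemma post_comp {p q : ℕ} (x : Ext A N n) (y : Ext N N' p) (g : N' ⟶ N'') (h : n + p = q) :
    post A g q (x.comp y h) = x.comp (post N g p y) h := by
  simp only [post_apply]
  rw [Ext.comp_assoc]
  all_goals omega

lemma pre_add (f g : A ⟶ B) (x : Ext B N n) :
    pre (f + g) N n x = pre f N n x + pre g N n x := by
  simp [pre_apply, Ext.mk₀_add, Ext.add_comp]

lemma pre_smul (r : R) (f : A ⟶ B) (x : Ext B N n) :
    pre (r • f) N n x = r • pre f N n x := by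
  simp [pre_apply, Ext.mk₀_smul]

lemma pre_zero (x : Ext B N n) : pre (0 : A ⟶ B) N n x = 0 := by
  simp [pre_apply]

lemma post_add (f g : N ⟶ N') (x : Ext A N n) :
    post A (f + g) n x = post A f n x + post A g n x := by
  simp [post_apply, Ext.mk₀_add]

lemma post_smul (r : R) (f : N ⟶ N') (x : Ext A N n) :
    post A (r • f) n x = r • post A f n x := by
  simp [post_apply, Ext.mk₀_smul]

lemma pre_mk₀ (f : A ⟶ B) (g : B ⟶ N) : pre f N 0 (Ext.mk₀ g) = Ext.mk₀ (f ≫ g) := by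
  simp [pre_apply]

lemma post_mk₀ (f : A ⟶ N) (g : N ⟶ N') : post A g 0 (Ext.mk₀ f) = Ext.mk₀ (f ≫ g) := by
  simp [post_apply]

end

/-- Local cohomology as a functor on modules. -/
abbrev LC (J : Ideal R) (i : ℕ) (N : ModuleCat.{0} R) : ModuleCat.{0} R :=
  (localCohomology J i).obj N

/-- The structure map of the colimit defining local cohomology. -/
def lcι (J : Ideal R) (i t : ℕ) (N : ModuleCat.{0} R) :
    ((_root_.Ext R (ModuleCat R) i).obj (op (Cyc (J ^ t)))).obj N →ₗ[R] LC J i N :=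
  ((Limits.colimit.ι (localCohomology.diagram (localCohomology.idealPowersDiagram J) i)
    (op (op t))).app N).hom

/-- The map from `Ext` of `R ⧸ J ^ t` to local cohomology. -/
def toLC (J : Ideal R) (i t : ℕ) (N : ModuleCat.{0} R) :
    Ext (Cyc (J ^ t)) N i →ₗ[R] LC J i N :=
  lcι J i t N ∘ₗ (ExtComparison.extEquiv (Cyc (J ^ t)) N i).symm.toLinearMap

lemma toLC_extEquiv (J : Ideal R) (i t : ℕ) (N : ModuleCat.{0} R)
    (x : ((_root_.Ext R (ModuleCat R) i).obj (op (Cyc (J ^ t)))).obj N) :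
    toLC J i t N (ExtComparison.extEquiv (Cyc (J ^ t)) N i x) = lcι J i t N x :=
  congrArg (lcι J i t N) (LinearEquiv.symm_apply_apply _ _)

variable (J : Ideal R) (i : ℕ)

lemma toLC_naturality (t : ℕ) {N N' : ModuleCat.{0} R} (f : N ⟶ N') (x : Ext (Cyc (J ^ t)) N i) :
    (localCohomology J i).map f (toLC J i t N x) = toLC J i t N' (post _ f i x) := by
  obtain ⟨x, rfl⟩ := (ExtComparison.extEquiv (Cyc (J ^ t)) N i).surjective x
  have := ExtComparison.extEquivOfRes_naturality_right (projectiveResolution (Cyc (J ^ t))) N i f x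
  rw [toLC_extEquiv, post_apply]
  refine Eq.trans ?_ ((toLC_extEquiv _ _ _ _ _).symm.trans (congrArg _ this))
  exact (ConcreteCategory.congr_hom ((Limits.colimit.ι (localCohomology.diagram
    (localCohomology.idealPowersDiagram J) i) (op (op t))).naturality f) x).symm

lemma toLC_pre {t s : ℕ} (h : t ≤ s) {N : ModuleCat.{0} R} (x : Ext (Cyc (J ^ t)) N i) :
    toLC J i s N (pre (quotMap (Ideal.pow_le_pow_right h)) N i x) = toLC J i t N x := by
  obtain ⟨x, rfl⟩ := (ExtComparison.extEquiv (Cyc (J ^ t)) N i).surjective x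
  have := ExtComparison.extEquivOfRes_naturality_left (projectiveResolution (Cyc (J ^ s))) N i
    (projectiveResolution (Cyc (J ^ t))) (quotMap (Ideal.pow_le_pow_right h)) x
  rw [toLC_extEquiv, pre_apply]
  refine (congrArg _ this.symm).trans ((toLC_extEquiv _ _ _ _ _).trans ?_)
  exact ConcreteCategory.congr_hom (congrArg (fun f => f.app N) (Limits.colimit.w
    (localCohomology.diagram (localCohomology.idealPowersDiagram J) i)
    (homOfLE h).op.op)) x

/-- The colimit cocone defining local cohomology, evaluated at a module. -/
def lcIsColimit (N : ModuleCat.{0} R) := Limits.isColimitOfPreserves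
  ((evaluation (ModuleCat R) (ModuleCat R)).obj N) (Limits.colimit.isColimit
    (localCohomology.diagram (localCohomology.idealPowersDiagram J) i))

lemma exists_toLC {N : ModuleCat.{0} R} (x : LC J i N) :
    ∃ t y, toLC J i t N y = x := by
  obtain ⟨t, y, hy⟩ := Limits.Concrete.isColimit_exists_rep _ (lcIsColimit J i N) x
  refine ⟨t.unop.unop, ExtComparison.extEquiv _ N i y, ?_⟩
  exact (toLC_extEquiv _ _ _ _ _).trans hy

lemma exists_pre_eq_zero {t : ℕ} {N : ModuleCat.{0} R} (x : Ext (Cyc (J ^ t)) N i)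
    (hx : toLC J i t N x = 0) :
    ∃ s, ∃ h : t ≤ s, pre (quotMap (Ideal.pow_le_pow_right h)) N i x = 0 := by
  obtain ⟨x, rfl⟩ := (ExtComparison.extEquiv (Cyc (J ^ t)) N i).surjective x
  rw [toLC_extEquiv] at hx
  obtain ⟨k, f, g, hk⟩ := Limits.Concrete.isColimit_exists_of_rep_eq _ (lcIsColimit J i N)
    (i := op (op t)) (j := op (op t)) x 0 (hx.trans (map_zero _).symm)
  have h : t ≤ k.unop.unop := leOfHom f.unop.unop
  refine ⟨k.unop.unop, h, ?_⟩
  have := ExtComparison.extEquivOfRes_naturality_left (projectiveResolution (Cyc (J ^ k.unop.unop)))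
    N i (projectiveResolution (Cyc (J ^ t))) (quotMap (Ideal.pow_le_pow_right h)) x
  refine Eq.trans this.symm ?_
  have h0 : ((_root_.Ext R (ModuleCat R) i).map
      (quotMap (Ideal.pow_le_pow_right (I := J) h)).op).app N x = 0 :=
    hk.trans (map_zero _)
  rw [h0]
  exact map_zero _

end ExtLC

namespace ExtLC

open Abelian

variable {R : Type} [CommRing R]

section

variable (J : Ideal R) (i : ℕ) {N : ModuleCat.{0} R}

lemma toLC_congr_pow {t s u : ℕ} (h : t ≤ u) (h' : s ≤ u) {x : Ext (Cyc (J ^ t)) N i}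
    {y : Ext (Cyc (J ^ s)) N i} (hxy : pre (quotMap (Ideal.pow_le_pow_right h)) N i x =
      pre (quotMap (Ideal.pow_le_pow_right h')) N i y) : toLC J i t N x = toLC J i s N y := by
  rw [← toLC_pre J i h, hxy, toLC_pre J i h']

lemma exists_toLC_of_le {N : ModuleCat.{0} R} (x : LC J i N) (t₀ : ℕ) :
    ∃ t, t₀ ≤ t ∧ ∃ y, toLC J i t N y = x := by
  obtain ⟨t, y, rfl⟩ := exists_toLC J i x
  exact ⟨max t t₀, le_max_right _ _, _, toLC_pre J i (le_max_left t t₀) y⟩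

lemma exists_toLC₂ {N : ModuleCat.{0} R} (x x' : LC J i N) :
    ∃ t y y', toLC J i t N y = x ∧ toLC J i t N y' = x' := by
  obtain ⟨t, y, rfl⟩ := exists_toLC J i x
  obtain ⟨t', ht, y', rfl⟩ := exists_toLC_of_le J i x' t
  exact ⟨t', _, y', toLC_pre J i ht y, rfl⟩

lemma toLC_eq_of {M : Type*} [AddCommGroup M] [Module R M]
    (φ : ∀ t, Ext (Cyc (J ^ t)) N i →ₗ[R] M)
    (hφ : ∀ t s (h : t ≤ s) x, φ s (pre (quotMap (Ideal.pow_le_pow_right h)) N i x) = φ t x)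
    {t s : ℕ} (x : Ext (Cyc (J ^ t)) N i) (y : Ext (Cyc (J ^ s)) N i)
    (h : toLC J i t N x = toLC J i s N y) : φ t x = φ s y := by
  have h1 := toLC_pre J i (le_max_left t s) x
  have h2 := toLC_pre J i (le_max_right t s) y
  rw [← hφ t _ (le_max_left t s), ← hφ s _ (le_max_right t s)]
  rw [← h1, ← h2, ← sub_eq_zero, ← map_sub] at h
  obtain ⟨u, hu, hz⟩ := exists_pre_eq_zero J i _ h
  rw [← sub_eq_zero, ← map_sub, ← hφ _ u hu, hz, map_zero]

/-- The universal property of local cohomology as a colimit. -/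
def lcDesc {M : Type*} [AddCommGroup M] [Module R M] (φ : ∀ t, Ext (Cyc (J ^ t)) N i →ₗ[R] M)
    (hφ : ∀ t s (h : t ≤ s) x, φ s (pre (quotMap (Ideal.pow_le_pow_right h)) N i x) = φ t x) :
    LC J i N →ₗ[R] M where
  toFun x := φ (exists_toLC J i x).choose (exists_toLC J i x).choose_spec.choose
  map_add' x y := by
    obtain ⟨t, a, b, ha, hb⟩ := exists_toLC₂ J i x y
    rw [toLC_eq_of J i φ hφ _ a ((exists_toLC J i x).choose_spec.choose_spec.trans ha.symm),
      toLC_eq_of J i φ hφ _ b ((exists_toLC J i y).choose_spec.choose_spec.trans hb.symm),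
      ← map_add]
    apply toLC_eq_of J i φ hφ
    rw [(exists_toLC J i (x + y)).choose_spec.choose_spec, map_add, ha, hb]
  map_smul' r x := by
    rw [RingHom.id_apply, ← map_smul]
    apply toLC_eq_of J i φ hφ
    rw [(exists_toLC J i (r • x)).choose_spec.choose_spec, map_smul,
      (exists_toLC J i x).choose_spec.choose_spec]

lemma lcDesc_toLC {M : Type*} [AddCommGroup M] [Module R M]
    (φ : ∀ t, Ext (Cyc (J ^ t)) N i →ₗ[R] M)
    (hφ : ∀ t s (h : t ≤ s) x, φ s (pre (quotMap (Ideal.pow_le_pow_right h)) N i x) = φ t x)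
    (t : ℕ) (x : Ext (Cyc (J ^ t)) N i) : lcDesc J i φ hφ (toLC J i t N x) = φ t x :=
  toLC_eq_of J i φ hφ _ _ (exists_toLC J i _).choose_spec.choose_spec

lemma lc_subsingleton (h : ∀ t, ∃ s, t ≤ s ∧ ∀ x : Ext (Cyc (J ^ s)) N i, x = 0) :
    Subsingleton (LC J i N) := by
  refine subsingleton_of_forall_eq 0 fun x => ?_
  obtain ⟨t, y, rfl⟩ := exists_toLC J i x
  obtain ⟨s, hs, h⟩ := h t
  rw [← toLC_pre J i hs, h (pre _ _ _ _), map_zero]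

/-- The map `R ⧸ b ⟶ A` determined by an element annihilated by `b`. -/
def evAt {A : ModuleCat.{0} R} (b : Ideal R) (a : A) (h : ∀ r ∈ b, r • a = 0) : Cyc b ⟶ A :=
  ModuleCat.ofHom (Submodule.liftQ b (LinearMap.toSpanSingleton R A a) (fun r hr => h r hr))

lemma evAt_mk {A : ModuleCat.{0} R} (b : Ideal R) (a : A) (h : ∀ r ∈ b, r • a = 0) (r : R) :
    evAt b a h (Submodule.Quotient.mk r) = r • a := rfl

lemma cyc_hom_ext {A : ModuleCat.{0} R} {b : Ideal R} {f g : Cyc b ⟶ A}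
    (h : f (Submodule.Quotient.mk 1) = g (Submodule.Quotient.mk 1)) : f = g := by
  ext
  exact h

lemma quotMap_evAt {A : ModuleCat.{0} R} {b b' : Ideal R} (hb : b ≤ b') (a : A)
    (h : ∀ r ∈ b', r • a = 0) :
    quotMap hb ≫ evAt b' a h = evAt b a (fun r hr => h r (hb hr)) :=
  cyc_hom_ext rfl

lemma evAt_comp {A B : ModuleCat.{0} R} {b : Ideal R} (f : A ⟶ B) (a : A)
    (h : ∀ r ∈ b, r • a = 0) :
    evAt b a h ≫ f = evAt b (f a) (fun r hr => by rw [← map_smul, h r hr, map_zero]) := by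
  apply cyc_hom_ext
  change f ((1 : R) • a) = (1 : R) • f a
  simp

lemma smul_ext_eq_zero {A : ModuleCat.{0} R} {n : ℕ} {r : R} (h : ∀ a : A, r • a = 0)
    (x : Ext A N n) : r • x = 0 := by
  have : (r • 𝟙 A : A ⟶ A) = 0 := by ext a; exact h a
  rw [← pre_id x, ← pre_smul, this, pre_zero]

lemma smul_cyc_eq_zero {b : Ideal R} {r : R} (hr : r ∈ b) (a : Cyc b) : r • a = 0 := by
  obtain ⟨a, rfl⟩ := Submodule.Quotient.mk_surjective _ a
  exact (Submodule.Quotient.mk_eq_zero b).2 (b.mul_mem_right a hr)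

/-- A module all of whose elements are annihilated by a power of `J`. -/
def IsTors (J : Ideal R) (M : Type*) [AddCommGroup M] [Module R M] : Prop :=
  ∀ a : M, ∃ t, ∀ r ∈ J ^ t, r • a = 0

lemma isTors_LC : IsTors J (LC J i N) := by
  intro x
  obtain ⟨t, y, rfl⟩ := exists_toLC J i x
  refine ⟨t, fun r hr => ?_⟩
  rw [← map_smul, smul_ext_eq_zero (smul_cyc_eq_zero hr), map_zero]

lemma isTors_cyc {b : Ideal R} {t : ℕ} (h : J ^ t ≤ b) : IsTors J (Cyc b) :=
  fun a => ⟨t, fun _ hr => smul_cyc_eq_zero (h hr) a⟩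

end

section Exact

variable {S : ShortComplex (ModuleCat.{0} R)} (hS : S.ShortExact) (J : Ideal R) (i : ℕ)

/-- The connecting homomorphism of local cohomology. -/
def lcδ : LC J i S.X₃ →ₗ[R] LC J (i + 1) S.X₁ :=
  lcDesc J i (fun t => toLC J (i + 1) t S.X₁ ∘ₗ Ext.postcompOfLinear hS.extClass R _ rfl) (by
    intro t s h x
    change toLC _ _ _ _ ((pre _ _ _ x).comp hS.extClass rfl) = toLC _ _ _ _ (x.comp hS.extClass rfl)
    rw [← pre_comp, toLC_pre _ _ h])

lemma lcδ_toLC (t : ℕ) (x : Ext (Cyc (J ^ t)) S.X₃ i) :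
    lcδ hS J i (toLC J i t _ x) = toLC J (i + 1) t _ (x.comp hS.extClass rfl) :=
  lcDesc_toLC _ _ _ _ _ _

lemma lc_exact₁ (x : LC J (i + 1) S.X₁) (hx : (localCohomology J (i + 1)).map S.f x = 0) :
    ∃ y, lcδ hS J i y = x := by
  obtain ⟨t, x, rfl⟩ := exists_toLC _ _ x
  rw [toLC_naturality] at hx
  obtain ⟨s, hs, h⟩ := exists_pre_eq_zero _ _ _ hx
  rw [pre_post] at h
  obtain ⟨y, hy⟩ := Ext.covariant_sequence_exact₁ _ hS _ h rfl
  exact ⟨toLC J i s _ y, by rw [lcδ_toLC, hy, toLC_pre _ _ hs]⟩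

lemma lc_exact₃ (x : LC J i S.X₃) (hx : lcδ hS J i x = 0) :
    ∃ y, (localCohomology J i).map S.g y = x := by
  obtain ⟨t, x, rfl⟩ := exists_toLC _ _ x
  rw [lcδ_toLC] at hx
  obtain ⟨s, hs, h⟩ := exists_pre_eq_zero _ _ _ hx
  rw [pre_comp] at h
  obtain ⟨y, hy⟩ := Ext.covariant_sequence_exact₃ _ hS _ rfl h
  refine ⟨toLC J i s _ y, ?_⟩
  rw [toLC_naturality, post_apply, hy, toLC_pre _ _ hs]

lemma map_lcδ (x : LC J i S.X₃) : (localCohomology J (i + 1)).map S.f (lcδ hS J i x) = 0 := by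
  obtain ⟨t, x, rfl⟩ := exists_toLC _ _ x
  rw [lcδ_toLC, toLC_naturality, post_comp, post_apply, hS.extClass_comp]
  simp

lemma lc_map_comp {A B C : ModuleCat.{0} R} (f : A ⟶ B) (g : B ⟶ C) (x : LC J i A) :
    (localCohomology J i).map g ((localCohomology J i).map f x) =
      (localCohomology J i).map (f ≫ g) x := by
  rw [Functor.map_comp]; rfl

lemma lc_map_add {A B : ModuleCat.{0} R} (f g : A ⟶ B) (x : LC J i A) :
    (localCohomology J i).map (f + g) x =
      (localCohomology J i).map f x + (localCohomology J i).map g x := by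
  obtain ⟨t, x, rfl⟩ := exists_toLC _ _ x
  simp only [toLC_naturality, post_add, map_add]

lemma lc_map_smul {A B : ModuleCat.{0} R} (r : R) (f : A ⟶ B) (x : LC J i A) :
    (localCohomology J i).map (r • f) x = r • (localCohomology J i).map f x := by
  obtain ⟨t, x, rfl⟩ := exists_toLC _ _ x
  simp only [toLC_naturality, post_smul, map_smul]

lemma lc_subsingleton_of_injective (Q : ModuleCat.{0} R) [Injective Q] :
    Subsingleton (LC J (i + 1) Q) :=
  lc_subsingleton _ _ fun t => ⟨t, le_rfl, fun x => x.eq_zero_of_injective⟩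

end Exact

end ExtLC

namespace ExtLC

open Abelian

variable {R : Type} [CommRing R]

section Torsion

variable (J : Ideal R)

/-- Baer's criterion for torsion modules: it suffices to extend maps from submodules of `R ⧸ J ^ n`. -/
lemma injective_of_isTors [IsNoetherianRing R] {H : Type} [AddCommGroup H] [Module R H]
    (hH : IsTors J H) (h : ∀ (n : ℕ) (X : Submodule R (R ⧸ J ^ n)) (g : X →ₗ[R] H),
      ∃ g' : (R ⧸ J ^ n) →ₗ[R] H, ∀ x : X, g' x = g x) : Module.Injective R H := by
  refine Module.Baer.injective fun a g => ?_
  obtain ⟨s, hs⟩ : ∃ s, ∀ r ∈ J ^ s, ∀ x, r • g x = 0 := by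
    obtain ⟨T, hT⟩ := IsNoetherian.noetherian (⊤ : Submodule R a)
    choose t ht using fun x : a => hH (g x)
    refine ⟨T.sup t, fun r hr x => ?_⟩
    have : (⊤ : Submodule R a) ≤ LinearMap.ker (r • g) := by
      rw [← hT, Submodule.span_le]
      intro y hy
      exact ht y r (Ideal.pow_le_pow_right (Finset.le_sup (f := t) hy) hr)
    exact this (Submodule.mem_top (x := x))
  obtain ⟨k, hk⟩ := Ideal.exists_pow_inf_eq_pow_smul (M := R) J a
  have hg : ∀ x : a, (x : R) ∈ J ^ (k + s) → g x = 0 := by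
    rintro ⟨x, hx⟩ hxJ
    have h1 : x ∈ J ^ s • (J ^ k • (⊤ : Submodule R R) ⊓ a) := by
      have := hk (k + s) (by simp)
      rw [Nat.add_sub_cancel_left] at this
      rw [← this]
      exact ⟨by simpa using hxJ, hx⟩
    have h2 : J ^ s • (J ^ k • (⊤ : Submodule R R) ⊓ a) ≤ Submodule.map (Submodule.subtype a) (LinearMap.ker g) := by
      rw [Submodule.smul_le]
      rintro r hr y ⟨-, hy⟩
      exact ⟨r • ⟨y, hy⟩, by rw [SetLike.mem_coe, LinearMap.mem_ker, map_smul, hs r hr], rfl⟩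
    obtain ⟨y, hy, rfl⟩ := h2 h1
    exact hy
  let X : Submodule R (R ⧸ J ^ (k + s)) := Submodule.map (J ^ (k + s)).mkQ a
  let p : a →ₗ[R] X := (J ^ (k + s)).mkQ.submoduleMap a
  have hp : Function.Surjective p := LinearMap.submoduleMap_surjective _ _
  have hker : LinearMap.ker p ≤ LinearMap.ker g := by
    intro x hx
    apply hg
    rw [LinearMap.mem_ker, Subtype.ext_iff] at hx
    exact (Submodule.Quotient.mk_eq_zero _).1 hx
  let g₀ : X →ₗ[R] H := (LinearMap.ker p).liftQ g hker ∘ₗ (p.quotKerEquivOfSurjective hp).symm.toLinearMap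
  obtain ⟨g', hg'⟩ := h _ X g₀
  refine ⟨g' ∘ₗ (J ^ (k + s)).mkQ, fun x hx => ?_⟩
  have h3 := hg' (p ⟨x, hx⟩)
  have h4 : (p.quotKerEquivOfSurjective hp).symm (p ⟨x, hx⟩) = Submodule.Quotient.mk ⟨x, hx⟩ := by
    rw [LinearEquiv.symm_apply_eq]; rfl
  change _ = (LinearMap.ker p).liftQ g hker ((p.quotKerEquivOfSurjective hp).symm (p ⟨x, hx⟩)) at h3
  rw [h4] at h3
  exact h3

/-- The `J`-torsion submodule. -/
def tors (M : Type) [AddCommGroup M] [Module R M] : Submodule R M where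
  carrier := {x | ∃ t, ∀ r ∈ J ^ t, r • x = 0}
  zero_mem' := ⟨0, fun r _ => smul_zero r⟩
  add_mem' := by
    rintro x y ⟨t, ht⟩ ⟨s, hs⟩
    refine ⟨max t s, fun r hr => ?_⟩
    rw [smul_add, ht r (Ideal.pow_le_pow_right (le_max_left _ _) hr),
      hs r (Ideal.pow_le_pow_right (le_max_right _ _) hr), add_zero]
  smul_mem' := by
    rintro c x ⟨t, ht⟩
    exact ⟨t, fun r hr => by rw [smul_comm, ht r hr, smul_zero]⟩

lemma isTors_tors (M : Type) [AddCommGroup M] [Module R M] : IsTors J (tors J M) := by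
  rintro ⟨x, t, ht⟩
  exact ⟨t, fun r hr => Subtype.ext (ht r hr)⟩

lemma IsTors.of_injective {J : Ideal R} {M M' : Type*} [AddCommGroup M] [Module R M] [AddCommGroup M']
    [Module R M'] (h : IsTors J M') (f : M →ₗ[R] M') (hf : Function.Injective f) : IsTors J M := by
  intro a
  obtain ⟨t, ht⟩ := h (f a)
  exact ⟨t, fun r hr => hf (by rw [map_smul, ht r hr, map_zero])⟩

lemma injective_tors [IsNoetherianRing R] (Q : Type) [AddCommGroup Q] [Module R Q] [Module.Injective R Q] :
    Module.Injective R (tors J Q) := by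
  refine injective_of_isTors J (isTors_tors J Q) fun n X g => ?_
  obtain ⟨g', hg'⟩ := Module.Injective.out X.subtype X.subtype_injective ((tors J Q).subtype ∘ₗ g)
  refine ⟨LinearMap.codRestrict _ g' fun x => ⟨n, fun r hr => ?_⟩, fun x => Subtype.ext (hg' x)⟩
  rw [← map_smul, smul_cyc_eq_zero hr x, map_zero]

lemma exists_retraction_tors [IsNoetherianRing R] (Q : Type) [AddCommGroup Q] [Module R Q]
    [Module.Injective R Q] : ∃ ρ : Q →ₗ[R] tors J Q, ∀ x : tors J Q, ρ x = x := by
  have := injective_tors J Q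
  exact Module.Injective.out (tors J Q).subtype (tors J Q).subtype_injective LinearMap.id

/-- A module without `J`-torsion embeds into an injective module without `J`-torsion. -/
lemma exists_injective_torsionFree [IsNoetherianRing R] (N : ModuleCat.{0} R)
    (hN : ∀ x : N, x ∈ tors J N → x = 0) :
    ∃ S : ShortComplex (ModuleCat.{0} R), S.X₁ = N ∧ S.ShortExact ∧ Injective S.X₂ ∧
      ∀ x : S.X₂, x ∈ tors J S.X₂ → x = 0 := by
  let Q := Injective.under N
  have : Injective (ModuleCat.of R Q) := inferInstanceAs (Injective (Injective.under N))
  have : Module.Injective R Q := Module.injective_module_of_injective_object R Q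
  obtain ⟨ρ, hρ⟩ := exists_retraction_tors J Q
  let π : Q →ₗ[R] LinearMap.ker ρ := LinearMap.codRestrict _ (LinearMap.id - (tors J Q).subtype ∘ₗ ρ)
    (fun x => by
      rw [LinearMap.mem_ker, LinearMap.sub_apply, map_sub, LinearMap.comp_apply, Submodule.subtype_apply, hρ]; simp)
  let Q' := ModuleCat.of R (LinearMap.ker ρ)
  have hQ' : Injective Q' := by
    refine Retract.injective (X := Q') (Y := Q) ⟨ModuleCat.ofHom (LinearMap.ker ρ).subtype,
      ModuleCat.ofHom π, ?_⟩
    ext x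
    change (x : Q) - (ρ x : Q) = x
    rw [LinearMap.mem_ker.1 x.2]
    simp
  let f : N ⟶ Q' := Injective.ι N ≫ ModuleCat.ofHom π
  have hι : Function.Injective (Injective.ι N) := (ModuleCat.mono_iff_injective _).1 inferInstance
  have hf : Function.Injective f := by
    rw [injective_iff_map_eq_zero]
    intro x hx
    have hx0 : π (Injective.ι N x) = 0 := hx
    have hx' : Injective.ι N x - (ρ (Injective.ι N x) : Q) = 0 := congrArg Subtype.val hx0
    apply hN
    rw [sub_eq_zero] at hx'
    obtain ⟨t, ht⟩ := (ρ (Injective.ι N x)).2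
    refine ⟨t, fun r hr => hι ?_⟩
    rw [map_smul, map_zero, hx', ht r hr]
  refine ⟨ShortComplex.mk f (ModuleCat.ofHom (LinearMap.range f.hom).mkQ)
    (by ext x; exact (Submodule.Quotient.mk_eq_zero _).2 ⟨x, rfl⟩), rfl, ?_, hQ', ?_⟩
  · have : Mono f := (ModuleCat.mono_iff_injective _).2 hf
    have : Epi (ModuleCat.ofHom (LinearMap.range f.hom).mkQ) :=
      (ModuleCat.epi_iff_surjective _).2 (Submodule.mkQ_surjective _)
    refine ShortComplex.ShortExact.mk' (ModuleCat.shortComplex_exact _ ?_) inferInstance inferInstance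
    exact LinearMap.exact_map_mkQ_range _
  · rintro ⟨x, hx⟩ ⟨t, ht⟩
    have h1 : x ∈ tors J Q := ⟨t, fun r hr => congrArg Subtype.val (ht r hr)⟩
    have h2 : ρ x = ⟨x, h1⟩ := hρ ⟨x, h1⟩
    rw [LinearMap.mem_ker.1 hx] at h2
    exact Subtype.ext (congrArg Subtype.val h2).symm

end Torsion

end ExtLC

namespace ExtLC

open Abelian

variable {R : Type} [CommRing R]

section Psi

variable {J : Ideal R} (i : ℕ) {A B : ModuleCat.{0} R} {N N' : ModuleCat.{0} R}

lemma toLC_pre_evAt_eq (a : A) {t s : ℕ} (h : ∀ r ∈ J ^ t, r • a = 0) (h' : ∀ r ∈ J ^ s, r • a = 0)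
    (x : Ext A N i) : toLC J i t N (pre (evAt _ a h) N i x) =
      toLC J i s N (pre (evAt _ a h') N i x) := by
  refine toLC_congr_pow J i (le_max_left t s) (le_max_right t s) ?_
  rw [pre_pre, pre_pre, quotMap_evAt, quotMap_evAt]

/-- The homomorphism `A → H^i_J(N)` induced by a class in `Ext^i(A, N)`, for `A` a
`J`-torsion module. -/
def psi (hA : IsTors J A) : Ext A N i →ₗ[R] A →ₗ[R] LC J i N :=
  LinearMap.mk₂ R (fun x a => toLC J i (hA a).choose N (pre (evAt _ a (hA a).choose_spec) N i x))
    (fun x y a => by rw [map_add, map_add])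
    (fun c x a => by rw [map_smul, map_smul])
    (fun x a b => by
      have h1 : ∀ r ∈ J ^ max (hA a).choose (hA b).choose, r • a = 0 := fun r hr =>
        (hA a).choose_spec r (Ideal.pow_le_pow_right (le_max_left _ _) hr)
      have h2 : ∀ r ∈ J ^ max (hA a).choose (hA b).choose, r • b = 0 := fun r hr =>
        (hA b).choose_spec r (Ideal.pow_le_pow_right (le_max_right _ _) hr)
      have h3 : ∀ r ∈ J ^ max (hA a).choose (hA b).choose, r • (a + b) = 0 := fun r hr => by
        rw [smul_add, h1 r hr, h2 r hr, add_zero]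
      rw [toLC_pre_evAt_eq i a _ h1, toLC_pre_evAt_eq i b _ h2, toLC_pre_evAt_eq i (a + b) _ h3,
        ← map_add, ← pre_add]
      congr 2
      exact congrArg (fun f => pre f N i) (cyc_hom_ext (smul_add _ _ _)))
    (fun c x a => by
      have h3 : ∀ r ∈ J ^ (hA a).choose, r • (c • a) = 0 := fun r hr => by
        rw [smul_comm, (hA a).choose_spec r hr, smul_zero]
      rw [toLC_pre_evAt_eq i (c • a) _ h3, ← map_smul, ← pre_smul]
      congr 2
      exact congrArg (fun f => pre f N i) (cyc_hom_ext (smul_comm _ _ _)))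

lemma psi_apply (hA : IsTors J A) (x : Ext A N i) (a : A) {t : ℕ} (h : ∀ r ∈ J ^ t, r • a = 0) :
    psi i hA x a = toLC J i t N (pre (evAt _ a h) N i x) :=
  toLC_pre_evAt_eq i a _ h x

lemma psi_pre (hA : IsTors J A) (hB : IsTors J B) (f : A ⟶ B) (x : Ext B N i) (a : A) :
    psi i hA (pre f N i x) a = psi i hB x (f a) := by
  obtain ⟨t, ht⟩ := hA a
  rw [psi_apply i hA _ a ht, psi_apply i hB _ (f a)
    (fun r hr => by rw [← map_smul, ht r hr, map_zero]), pre_pre, evAt_comp]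

lemma psi_post (hA : IsTors J A) (g : N ⟶ N') (x : Ext A N i) (a : A) :
    psi i hA (post A g i x) a = (localCohomology J i).map g (psi i hA x a) := by
  obtain ⟨t, ht⟩ := hA a
  rw [psi_apply i hA _ a ht, psi_apply i hA _ a ht, pre_post, toLC_naturality]

lemma psi_extClass {S : ShortComplex (ModuleCat.{0} R)} (hS : S.ShortExact) (hA : IsTors J A)
    (x : Ext A S.X₃ i) (a : A) :
    psi (i + 1) hA (x.comp hS.extClass rfl) a = lcδ hS J i (psi i hA x a) := by
  obtain ⟨t, ht⟩ := hA a
  rw [psi_apply _ hA _ a ht, psi_apply _ hA _ a ht, pre_comp, lcδ_toLC]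

lemma toLC_mk₀_evAt_eq_zero {t : ℕ} (a : N) (h : ∀ r ∈ J ^ t, r • a = 0)
    (h0 : toLC J 0 t N (Ext.mk₀ (evAt _ a h)) = 0) : a = 0 := by
  obtain ⟨s, hs, h1⟩ := exists_pre_eq_zero J 0 _ h0
  rw [pre_mk₀, Ext.mk₀_eq_zero_iff, quotMap_evAt] at h1
  have := congrArg (fun f => f (Submodule.Quotient.mk 1)) h1
  rw [← one_smul R a]
  exact this

/-- Classes of degree zero as linear maps. -/
def extHom (A N : ModuleCat.{0} R) : Ext A N 0 ≃ₗ[R] A →ₗ[R] N :=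
  (Ext.linearEquiv₀ (R := R)).trans (ModuleCat.homLinearEquiv (S := R))

lemma extHom_mk₀ (f : A ⟶ N) : extHom A N (Ext.mk₀ f) = f.hom :=
  congrArg ModuleCat.Hom.hom (Ext.homEquiv₀.apply_symm_apply f)

/-- The embedding of `H^0_J(N)` in `N`. -/
def lcZero (J : Ideal R) (N : ModuleCat.{0} R) : LC J 0 N →ₗ[R] N :=
  lcDesc J 0 (fun t => LinearMap.applyₗ (R := R) (M := Cyc (J ^ t)) (M₂ := N)
    (Submodule.Quotient.mk 1 : Cyc (J ^ t)) ∘ₗ (extHom _ _).toLinearMap) (by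
    intro t s h x
    obtain ⟨f, rfl⟩ := (Ext.mk₀_bijective _ _).2 x
    rw [pre_mk₀]
    simp only [LinearMap.comp_apply, LinearEquiv.coe_coe]
    erw [extHom_mk₀, extHom_mk₀]
    rfl)

lemma lcZero_mk₀ (t : ℕ) (f : Cyc (J ^ t) ⟶ N) :
    lcZero J N (toLC J 0 t N (Ext.mk₀ f)) = f (Submodule.Quotient.mk 1) := by
  rw [lcZero, lcDesc_toLC, LinearMap.comp_apply, LinearEquiv.coe_coe, extHom_mk₀]
  rfl

lemma toLC_evAt_lcZero (z : LC J 0 N) {t : ℕ} (h : ∀ r ∈ J ^ t, r • lcZero J N z = 0) :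
    toLC J 0 t N (Ext.mk₀ (evAt _ (lcZero J N z) h)) = z := by
  obtain ⟨s, hs, y, rfl⟩ := exists_toLC_of_le J 0 z t
  obtain ⟨f, rfl⟩ := (Ext.mk₀_bijective _ _).2 y
  rw [← toLC_pre _ _ hs, pre_mk₀, quotMap_evAt]
  congr 2
  apply cyc_hom_ext
  rw [evAt_mk, one_smul, lcZero_mk₀]

lemma psi_zero_bijective (hA : IsTors J A) : Function.Bijective (psi 0 hA (N := N)) := by
  constructor
  · rw [injective_iff_map_eq_zero]
    intro x hx
    obtain ⟨f, rfl⟩ := (Ext.mk₀_bijective _ _).2 x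
    rw [Ext.mk₀_eq_zero_iff]
    ext a
    obtain ⟨t, ht⟩ := hA a
    have := LinearMap.congr_fun hx a
    rw [psi_apply 0 hA _ a ht, pre_mk₀, evAt_comp] at this
    exact toLC_mk₀_evAt_eq_zero _ _ this
  · intro g
    refine ⟨Ext.mk₀ (ModuleCat.ofHom (lcZero J N ∘ₗ g)), LinearMap.ext fun a => ?_⟩
    obtain ⟨t, ht⟩ := hA a
    rw [psi_apply 0 hA _ a ht, pre_mk₀, evAt_comp]
    exact toLC_evAt_lcZero (g a) _

lemma lc_zero_subsingleton (J : Ideal R) (N : ModuleCat.{0} R) (h : ∀ x : N, x ∈ tors J N → x = 0) :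
    Subsingleton (LC J 0 N) := by
  refine lc_subsingleton J 0 fun t => ⟨t, le_rfl, fun x => ?_⟩
  obtain ⟨f, rfl⟩ := (Ext.mk₀_bijective _ _).2 x
  rw [Ext.mk₀_eq_zero_iff]
  apply cyc_hom_ext
  refine h _ ⟨t, fun r hr => ?_⟩
  rw [← map_smul, smul_cyc_eq_zero hr, map_zero]

lemma eq_zero_of_mem_tors [Subsingleton (LC J 0 N)] (x : N) (hx : x ∈ tors J N) : x = 0 := by
  obtain ⟨t, ht⟩ := hx
  exact toLC_mk₀_evAt_eq_zero x ht (Subsingleton.elim _ _)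

lemma ext_eq_zero_of_torsionFree (Q : ModuleCat.{0} R) [Injective Q]
    (hQ : ∀ x : Q, x ∈ tors J Q → x = 0) (hA : IsTors J A) : ∀ (i : ℕ) (x : Ext A Q i), x = 0
  | 0, x => by
    obtain ⟨f, rfl⟩ := (Ext.mk₀_bijective _ _).2 x
    rw [Ext.mk₀_eq_zero_iff]
    ext a
    obtain ⟨t, ht⟩ := hA a
    exact hQ _ ⟨t, fun r hr => by rw [← map_smul, ht r hr, map_zero]⟩
  | _ + 1, x => x.eq_zero_of_injective

/-- For a `J`-torsion module `A`, `Ext^i(A, N) = Hom(A, H^i_J(N))` if `H^j_J(N) = 0` for `j < i`. -/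
theorem psi_bijective [IsNoetherianRing R] (hA : IsTors J A) :
    ∀ (N : ModuleCat.{0} R), (∀ j < i, Subsingleton (LC J j N)) →
      Function.Bijective (psi i hA (N := N)) := by
  induction i with
  | zero => exact fun N _ => psi_zero_bijective hA
  | succ i ih =>
    intro N hN
    have := hN 0 (Nat.succ_pos _)
    obtain ⟨S, rfl, hS, hQ, hQ'⟩ := exists_injective_torsionFree J N eq_zero_of_mem_tors
    have hl : ∀ j, Subsingleton (LC J j S.X₂)
      | 0 => lc_zero_subsingleton J _ hQ'
      | j + 1 => lc_subsingleton_of_injective J j _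
    have hδ : ∀ j, Function.Bijective (lcδ hS J j) := by
      refine fun j => ⟨?_, fun x => lc_exact₁ hS J j x (Subsingleton.elim (h := hl _) _ _)⟩
      rw [injective_iff_map_eq_zero]
      intro x hx
      obtain ⟨y, rfl⟩ := lc_exact₃ hS J j x hx
      rw [Subsingleton.elim (h := hl _) y 0, map_zero]
    have hb := ih S.X₃ fun j hj => by
      have := hN (j + 1) (by omega)
      exact (hδ j).1.subsingleton
    constructor
    · rw [injective_iff_map_eq_zero]
      intro x hx
      obtain ⟨y, rfl⟩ := Ext.covariant_sequence_exact₁ _ hS x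
        (ext_eq_zero_of_torsionFree _ hQ' hA _ _) rfl
      have : psi i hA y = 0 := LinearMap.ext fun a => (hδ i).1 <| by
        rw [← psi_extClass, hx]; simp
      rw [(map_eq_zero_iff _ hb.1).1 this]
      simp
    · intro g
      let e := LinearEquiv.ofBijective _ (hδ i)
      obtain ⟨y, hy⟩ := hb.2 (e.symm.toLinearMap ∘ₗ g)
      refine ⟨y.comp hS.extClass rfl, LinearMap.ext fun a => ?_⟩
      rw [psi_extClass, hy]
      exact e.apply_symm_apply (g a)

end Psi

end ExtLC

namespace ExtLC

open Abelian

variable {R : Type} [CommRing R]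

section CyclicClasses

variable {J b : Ideal R} (i : ℕ) {t : ℕ} {N N' : ModuleCat.{0} R}

/-- The map `Ext^i(R ⧸ b, N) → H^i_J(N)` for an ideal `b` containing a power of `J`. -/
def ofCyc (hb : J ^ t ≤ b) : Ext (Cyc b) N i →ₗ[R] LC J i N :=
  toLC J i t N ∘ₗ pre (quotMap hb) N i

lemma ofCyc_eq_psi (hb : J ^ t ≤ b) (x : Ext (Cyc b) N i) :
    ofCyc i hb x = psi i (isTors_cyc _ hb) x (Submodule.Quotient.mk 1 : Cyc b) := by
  have h : ∀ r ∈ J ^ t, r • (Submodule.Quotient.mk 1 : Cyc b) = 0 :=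
    fun r hr => smul_cyc_eq_zero (hb hr) _
  rw [psi_apply i _ _ _ h]
  change toLC J i t N (pre _ _ _ _) = _
  congr 2
  exact congrArg (fun f => pre f N i) (cyc_hom_ext (by rw [evAt_mk, one_smul]; rfl))

lemma ofCyc_pre (hb : J ^ t ≤ b) {b' : Ideal R} {t' : ℕ} (hb' : J ^ t' ≤ b') (h : b' ≤ b)
    (x : Ext (Cyc b) N i) : ofCyc i hb' (pre (quotMap h) N i x) = ofCyc i hb x := by
  rw [ofCyc_eq_psi, ofCyc_eq_psi, psi_pre i _ (isTors_cyc _ hb)]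
  rfl

lemma ofCyc_post (hb : J ^ t ≤ b) (g : N ⟶ N') (x : Ext (Cyc b) N i) :
    ofCyc i hb (post _ g i x) = (localCohomology J i).map g (ofCyc i hb x) := by
  rw [ofCyc_eq_psi, ofCyc_eq_psi, psi_post]

lemma smul_ofCyc_eq_zero (hb : J ^ t ≤ b) (x : Ext (Cyc b) N i) {r : R} (hr : r ∈ b) :
    r • ofCyc i hb x = 0 := by
  rw [← map_smul, smul_ext_eq_zero (smul_cyc_eq_zero hr), map_zero]

lemma exists_ofCyc_of_le (x : LC J i N) (t₀ : ℕ) :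
    ∃ t, t₀ ≤ t ∧ ∃ y, ofCyc i (le_refl (J ^ t)) y = x := by
  obtain ⟨t, ht, y, rfl⟩ := exists_toLC_of_le J i x t₀
  refine ⟨t, ht, y, ?_⟩
  change toLC J i t N (pre _ _ _ _) = _
  rw [quotMap_refl, pre_id]

variable [IsNoetherianRing R]

lemma ofCyc_injective (hN : ∀ j < i, Subsingleton (LC J j N)) (hb : J ^ t ≤ b) :
    Function.Injective (ofCyc (N := N) i hb) := by
  rw [injective_iff_map_eq_zero]
  intro x hx
  apply (map_eq_zero_iff _ (psi_bijective i (isTors_cyc _ hb) N hN).1).1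
  rw [ofCyc_eq_psi] at hx
  exact Submodule.linearMap_qext _ (LinearMap.ext_ring hx)

lemma exists_ofCyc (hN : ∀ j < i, Subsingleton (LC J j N)) (hb : J ^ t ≤ b) (h : LC J i N)
    (hh : ∀ r ∈ b, r • h = 0) : ∃ x : Ext (Cyc b) N i, ofCyc i hb x = h := by
  obtain ⟨x, hx⟩ := (psi_bijective i (isTors_cyc _ hb) N hN).2
    (Submodule.liftQ b (LinearMap.toSpanSingleton R _ h) (fun r hr => hh r hr))
  refine ⟨x, ?_⟩
  rw [ofCyc_eq_psi, hx]
  exact one_smul R h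

end CyclicClasses

lemma shortExact_mk {A B C : ModuleCat.{0} R} (f : A ⟶ B) (g : B ⟶ C) (hf : Function.Injective f)
    (hg : Function.Surjective g) (h : Function.Exact f g) :
    (ShortComplex.mk f g (by ext x; exact h.apply_apply_eq_zero x)).ShortExact := by
  have : Mono f := (ModuleCat.mono_iff_injective _).2 hf
  have : Epi g := (ModuleCat.epi_iff_surjective _).2 hg
  exact ShortComplex.ShortExact.mk' (ModuleCat.shortComplex_exact _ h) ‹_› ‹_›

section Vanishing

open IsLocalRing

variable {ω : ModuleCat.{0} R}

lemma ext_eq_zero_of_linearEquiv {A B : ModuleCat.{0} R} (e : A ≃ₗ[R] B) {i : ℕ}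
    (h : ∀ x : Ext B ω i, x = 0) (x : Ext A ω i) : x = 0 := by
  rw [← pre_id x, ← (e.toModuleIso).hom_inv_id, ← pre_pre, h (pre _ _ _ x), map_zero]

lemma ext_eq_zero_of_exact {A B C : ModuleCat.{0} R} (f : A ⟶ B) (g : B ⟶ C)
    (hf : Function.Injective f) (hg : Function.Surjective g) (h : Function.Exact f g) {i : ℕ}
    (hA : ∀ x : Ext A ω i, x = 0) (hC : ∀ x : Ext C ω i, x = 0) (x : Ext B ω i) : x = 0 := by
  obtain ⟨y, rfl⟩ := Ext.contravariant_sequence_exact₂ (shortExact_mk f g hf hg h) ω x (hA _)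
  rw [hC y, Ext.comp_zero]

lemma ext_eq_zero_of_subsingleton {A : ModuleCat.{0} R} [Subsingleton A] {i : ℕ}
    (x : Ext A ω i) : x = 0 := by
  rw [← pre_id x, show 𝟙 A = 0 by ext; exact Subsingleton.elim _ _, pre_zero]

variable [IsLocalRing R] [IsNoetherianRing R] {d : ℕ}

lemma ext_eq_zero_of_pow_smul (hω : ∀ i ≠ d, ∀ x : Ext (Cyc (maximalIdeal R)) ω i, x = 0)
    {i : ℕ} (hi : i ≠ d) (L : ModuleCat.{0} R) [Module.Finite R L] {n : ℕ}
    (hL : ∀ r ∈ maximalIdeal R ^ n, ∀ x : L, r • x = 0) (x : Ext L ω i) : x = 0 := by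
  refine IsNoetherianRing.induction_on_isQuotientEquivQuotientPrime R (M := L) inferInstance
    (motive := fun N _ _ _ => (∀ r ∈ maximalIdeal R ^ n, ∀ x : N, r • x = 0) →
      ∀ x : Ext (ModuleCat.of R N) ω i, x = 0) ?_ ?_ ?_ hL x
  · intro N _ _ _ _ _ x
    have : Subsingleton (ModuleCat.of R N) := ‹Subsingleton N›
    exact ext_eq_zero_of_subsingleton x
  · intro N _ _ _ p e h
    have hp : p.1 = maximalIdeal R := by
      have : maximalIdeal R ≤ p.1 := by
        refine p.2.le_of_pow_le (n := n) fun r hr => ?_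
        have := h r hr (e.symm (Submodule.Quotient.mk 1))
        rw [← map_smul, LinearEquiv.map_eq_zero_iff, ← Submodule.Quotient.mk_smul,
          Submodule.Quotient.mk_eq_zero] at this
        simpa using this
      exact ((maximalIdeal.isMaximal R).eq_of_le p.2.ne_top this).symm
    exact ext_eq_zero_of_linearEquiv (A := ModuleCat.of R N) (B := Cyc (maximalIdeal R))
      (hp ▸ e) (hω i hi)
  · intro N₁ _ _ _ N₂ _ _ _ N₃ _ _ _ f g hf hg hfg h₁ h₃ h
    refine ext_eq_zero_of_exact (ModuleCat.ofHom f) (ModuleCat.ofHom g) hf hg hfg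
      (h₁ fun r hr x => hf ?_) (h₃ fun r hr x => ?_)
    · rw [map_smul, h r hr, map_zero]
    · obtain ⟨y, rfl⟩ := hg x
      rw [← map_smul, h r hr, map_zero]

end Vanishing

end ExtLC

namespace ExtLC

open Abelian IsLocalRing

open scoped Pointwise

/-- Multiplication by a ring element, as an endomorphism. -/
abbrev smulHom {R : Type} [CommRing R] (x : R) (B : ModuleCat.{0} R) : B ⟶ B :=
  ModuleCat.ofHom (LinearMap.lsmul R B x)

lemma exact_quotSMulTop {R : Type} [CommRing R] (B : ModuleCat.{0} R) (x : R) :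
    Function.Exact (smulHom x B) (ModuleCat.ofHom (Y := ModuleCat.of R (QuotSMulTop x B))
      (x • (⊤ : Submodule R B)).mkQ) := by
  intro y
  change Submodule.Quotient.mk y = 0 ↔ _
  rw [Submodule.Quotient.mk_eq_zero]
  constructor
  · rintro ⟨w, -, hw⟩; exact ⟨w, hw⟩
  · rintro ⟨w, hw⟩; exact ⟨w, trivial, hw⟩

lemma shortExact_quotSMulTop {R : Type} [CommRing R] (B : ModuleCat.{0} R) {x : R}
    (reg : IsSMulRegular B x) :
    (ShortComplex.mk (smulHom x B) (ModuleCat.ofHom (Y := ModuleCat.of R (QuotSMulTop x B))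
      (x • (⊤ : Submodule R B)).mkQ)
      (by ext y; exact (exact_quotSMulTop B x).apply_apply_eq_zero y)).ShortExact :=
  shortExact_mk (A := B) (B := B) (C := ModuleCat.of R (QuotSMulTop x B))
    (smulHom x B) (ModuleCat.ofHom (x • (⊤ : Submodule R B)).mkQ)
    reg (Submodule.mkQ_surjective _) (exact_quotSMulTop B x)

lemma pre_smulHom {R : Type} [CommRing R] (x : R) {B N : ModuleCat.{0} R} {i : ℕ}
    (w : Ext B N i) : pre (smulHom x B) N i w = x • w := by
  rw [← pre_id (x • w), map_smul, ← pre_smul]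
  rfl

lemma post_smulHom {R : Type} [CommRing R] (x : R) {B N : ModuleCat.{0} R} {i : ℕ}
    (w : Ext B N i) : post B (smulHom x N) i w = x • w := by
  rw [← post_id (x • w), map_smul, ← post_smul]
  rfl

variable {R : Type} [CommRing R] [IsLocalRing R] [IsNoetherianRing R] {d : ℕ} {ω : ModuleCat.{0} R}

lemma ext_eq_zero_of_isSMulRegular [Module.Finite R ω] (B : ModuleCat.{0} R) [Module.Finite R B]
    {x : R} (hx : x ∈ maximalIdeal R) (reg : IsSMulRegular B x) {i : ℕ}
    (h : ∀ y : Ext (ModuleCat.of R (QuotSMulTop x B)) ω (i + 1), y = 0) (z : Ext B ω i) : z = 0 := by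
  have hS := shortExact_quotSMulTop B reg
  have := ModuleCat.finite_ext R B ω i
  have h1 : (⊤ : Submodule R (Ext B ω i)) = ⊥ := by
    refine Submodule.eq_bot_of_le_smul_of_le_jacobson_bot (maximalIdeal R) _ Module.Finite.fg_top ?_
      (maximalIdeal_le_jacobson _)
    intro y _
    obtain ⟨w, rfl⟩ := Ext.contravariant_sequence_exact₁ hS ω y (add_comm 1 i) (h _)
    change pre (smulHom x B) ω i w ∈ _
    rw [pre_smulHom]
    exact Submodule.smul_mem_smul hx trivial
  exact (Submodule.mem_bot R).1 (h1 ▸ Submodule.mem_top (x := z))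

/-- Ischebeck's theorem for a module `ω` of depth at least `d`. -/
theorem ext_eq_zero_of_supportDim_lt [Module.Finite R ω]
    (hω : ∀ i < d, ∀ x : Ext (Cyc (maximalIdeal R)) ω i, x = 0) (r : ℕ) :
    ∀ (B : ModuleCat.{0} R) [Module.Finite R B], Module.supportDim R B < r →
      ∀ i, i + r ≤ d → ∀ x : Ext B ω i, x = 0 := by
  induction r with
  | zero =>
    intro B _ hB i _ x
    have : Subsingleton B := by
      by_contra h
      rw [not_subsingleton_iff_nontrivial] at h
      have h1 := Module.supportDim_ne_bot_of_nontrivial R B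
      generalize Module.supportDim R B = s at *
      cases s with
      | bot => exact h1 rfl
      | coe s => exact absurd (WithBot.coe_lt_coe.1 hB) not_lt_zero
    exact ext_eq_zero_of_subsingleton x
  | succ r ih =>
    intro B _ hB i hi x
    refine IsNoetherianRing.induction_on_isQuotientEquivQuotientPrime R (M := B) inferInstance
      (motive := fun N _ _ _ => Module.supportDim R N < ((r + 1 : ℕ) : WithBot ℕ∞) →
        ∀ x : Ext (ModuleCat.of R N) ω i, x = 0) ?_ ?_ ?_ hB x
    · intro N _ _ _ _ _ x
      have : Subsingleton (ModuleCat.of R N) := ‹Subsingleton N›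
      exact ext_eq_zero_of_subsingleton x
    · intro N _ _ _ p e h
      by_cases hp : maximalIdeal R ≤ p.1
      · have hp := ((maximalIdeal.isMaximal R).eq_of_le p.2.ne_top hp).symm
        exact ext_eq_zero_of_linearEquiv (A := ModuleCat.of R N) (B := Cyc (maximalIdeal R))
          (hp ▸ e) (hω i (by omega))
      · obtain ⟨y, hy, hyp⟩ := Set.not_subset.1 hp
        have reg : IsSMulRegular N y := by
          rw [e.isSMulRegular_congr, isSMulRegular_iff_right_eq_zero_of_smul]
          intro z hz
          obtain ⟨z, rfl⟩ := Submodule.Quotient.mk_surjective _ z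
          rw [← Submodule.Quotient.mk_smul, Submodule.Quotient.mk_eq_zero, smul_eq_mul] at hz
          exact (Submodule.Quotient.mk_eq_zero _).2 ((p.2.mem_or_mem hz).resolve_left hyp)
        have hdim := Module.supportDim_quotSMulTop_succ_eq_supportDim reg hy
        refine ext_eq_zero_of_isSMulRegular (ModuleCat.of R N) hy reg (ih _ ?_ _ (by omega))
        rw [← hdim] at h
        push_cast at h
        exact lt_of_add_lt_add_right h
    · intro N₁ _ _ _ N₂ _ _ _ N₃ _ _ _ f g hf hg hfg h₁ h₃ h
      exact ext_eq_zero_of_exact (ModuleCat.ofHom f) (ModuleCat.ofHom g) hf hg hfg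
        (h₁ ((Module.supportDim_le_of_injective f hf).trans_lt h))
        (h₃ ((Module.supportDim_le_of_surjective g hg).trans_lt h))

lemma length_le_of_isRegular {d : ℕ} (hd : ringKrullDim R = d) (rs : List R)
    (reg : RingTheory.Sequence.IsRegular R rs) : rs.length ≤ d := by
  have : (rs.length : WithBot ℕ∞) ≤ d := by
    rw [← hd, ← ringKrullDim_add_length_eq_ringKrullDim_of_isRegular rs reg]
    have : Nontrivial (R ⧸ Ideal.ofList rs) := Ideal.Quotient.nontrivial_iff.2 (by
      intro h; exact reg.2 (by rw [h]; simp))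
    exact le_add_of_nonneg_left ringKrullDim_nonneg_of_nontrivial
  exact_mod_cast this

lemma lc_subsingleton_of_isRegular [Module.Finite R ω] (hd : ringKrullDim R = d)
    (hω : ∀ i < d, ∀ x : Ext (Cyc (maximalIdeal R)) ω i, x = 0) (I : Ideal R) (rs : List R)
    (hrs : ∀ r ∈ rs, r ∈ I) (reg : RingTheory.Sequence.IsRegular R rs) (i : ℕ) (hi : i < rs.length) :
    Subsingleton (LC I i ω) := by
  have h1 := ringKrullDim_add_length_eq_ringKrullDim_of_isRegular rs reg
  have hc := length_le_of_isRegular hd rs reg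
  refine lc_subsingleton I i fun t => ⟨t + 1, Nat.le_succ t, ?_⟩
  refine ext_eq_zero_of_supportDim_lt hω (d - rs.length + 1) _ ?_ _ (by omega)
  have h2 : Module.supportDim R (R ⧸ I ^ (t + 1)) ≤ Module.supportDim R (R ⧸ Ideal.ofList rs) := by
    have hsub : Module.support R (R ⧸ I ^ (t + 1)) ⊆ Module.support R (R ⧸ Ideal.ofList rs) := by
      rw [Module.support_eq_zeroLocus, Ideal.annihilator_quotient, Module.support_eq_zeroLocus,
        Ideal.annihilator_quotient, PrimeSpectrum.zeroLocus_pow _ (Nat.succ_ne_zero t)]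
      exact PrimeSpectrum.zeroLocus_anti_mono (SetLike.coe_subset_coe.2 (Ideal.span_le.2 hrs))
    exact Order.krullDim_le_of_strictMono (fun a => ⟨a.1, hsub a.2⟩) fun _ _ h => h
  refine h2.trans_lt ?_
  rw [Module.supportDim_quotient_eq_ringKrullDim]
  refine lt_of_add_lt_add_right (a := (rs.length : WithBot ℕ∞)) ?_
  rw [h1, hd]
  exact_mod_cast (by omega : d < d - rs.length + 1 + rs.length)

lemma lc_maximalIdeal_subsingleton (hω : ∀ i ≠ d, ∀ x : Ext (Cyc (maximalIdeal R)) ω i, x = 0)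
    (i : ℕ) (hi : i < d) : Subsingleton (LC (maximalIdeal R) i ω) :=
  lc_subsingleton _ i fun t => ⟨t, le_rfl, fun x =>
    ext_eq_zero_of_pow_smul hω hi.ne _ (n := t) (fun _ hr a => smul_cyc_eq_zero hr a) x⟩

/-- The top local cohomology module of the canonical module is injective. -/
theorem injective_lc (hω : ∀ i ≠ d, ∀ x : Ext (Cyc (maximalIdeal R)) ω i, x = 0) :
    Module.Injective R (LC (maximalIdeal R) d ω) := by
  refine injective_of_isTors (maximalIdeal R) (isTors_LC _ _) fun n X g => ?_
  have hl := lc_maximalIdeal_subsingleton hω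
  have hY : ∀ r ∈ maximalIdeal R ^ n, ∀ y : R ⧸ maximalIdeal R ^ n, r • y = 0 :=
    fun r hr y => smul_cyc_eq_zero hr y
  have tY : IsTors (maximalIdeal R) (Cyc (maximalIdeal R ^ n)) := isTors_cyc _ le_rfl
  have tX : IsTors (maximalIdeal R) (ModuleCat.of R X) :=
    tY.of_injective X.subtype X.subtype_injective
  obtain ⟨x, hx⟩ := (psi_bijective d tX ω hl).2 g
  have hS := shortExact_mk (A := ModuleCat.of R X) (B := Cyc (maximalIdeal R ^ n))
    (C := ModuleCat.of R ((R ⧸ maximalIdeal R ^ n) ⧸ X))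
    (ModuleCat.ofHom X.subtype) (ModuleCat.ofHom X.mkQ) X.subtype_injective X.mkQ_surjective
    (LinearMap.exact_subtype_mkQ X)
  obtain ⟨y, rfl⟩ := Ext.contravariant_sequence_exact₁ hS ω x (add_comm 1 d)
    (ext_eq_zero_of_pow_smul hω (Nat.succ_ne_self d) _ (n := n) (fun r hr z => by
      obtain ⟨z, rfl⟩ := X.mkQ_surjective z
      rw [← map_smul, hY r hr, map_zero]) _)
  refine ⟨psi d tY y, fun a => ?_⟩
  rw [← hx]
  exact (psi_pre d tX tY (ModuleCat.ofHom X.subtype) y a).symm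

end ExtLC

namespace ExtLC

open Abelian IsLocalRing RingTheory.Sequence

open scoped Pointwise

section TopClass

variable {R : Type} [CommRing R]

/-- The map `R ⟶ N` sending `1` to `n`. -/
def elt {N : ModuleCat.{0} R} (n : N) : ModuleCat.of R R ⟶ N :=
  ModuleCat.ofHom (LinearMap.toSpanSingleton R N n)

lemma elt_comp {N N' : ModuleCat.{0} R} (n : N) (f : N ⟶ N') : elt n ≫ f = elt (f n) := by
  refine ModuleCat.hom_ext (LinearMap.ext_ring ?_)
  change f ((1 : R) • n) = (1 : R) • f n
  rw [one_smul, one_smul]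

lemma elt_apply_one {N : ModuleCat.{0} R} (f : ModuleCat.of R R ⟶ N) : elt (f (1 : R)) = f := by
  refine ModuleCat.hom_ext (LinearMap.ext_ring ?_)
  exact one_smul R _

lemma elt_add {N : ModuleCat.{0} R} (n n' : N) : elt (n + n') = elt n + elt n' :=
  ModuleCat.hom_ext (LinearMap.ext fun r => smul_add r n n')

lemma elt_smul {N : ModuleCat.{0} R} (r : R) (n : N) : elt (r • n) = r • elt n :=
  ModuleCat.hom_ext (LinearMap.ext fun s => smul_comm s r n)

/-- `B` has projective dimension at most `k`, and `Ext^k(B, N)` is a quotient of `N` by a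
submodule of `J • N`, naturally in `N`. -/
structure TopClass (B : ModuleCat.{0} R) (J : Ideal R) (k : ℕ) : Prop where
  vanish : ∀ (N : ModuleCat.{0} R) (i : ℕ), k < i → ∀ x : Ext B N i, x = 0
  gen : ∃ u : Ext B (ModuleCat.of R R) k, ∀ N : ModuleCat.{0} R,
    (∀ y : Ext B N k, ∃ n : N, y = post B (elt n) k u) ∧
    ∀ n : N, post B (elt n) k u = 0 → n ∈ J • (⊤ : Submodule R N)

lemma TopClass.base : TopClass (ModuleCat.of R R) ⊥ 0 where
  vanish N i hi x := by
    obtain ⟨i, rfl⟩ := Nat.exists_eq_succ_of_ne_zero hi.ne'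
    exact Ext.eq_zero_of_projective x
  gen := by
    refine ⟨Ext.mk₀ (𝟙 _), fun N => ⟨fun y => ?_, fun n hn => ?_⟩⟩
    · obtain ⟨f, rfl⟩ := (Ext.mk₀_bijective _ _).2 y
      exact ⟨f (1 : R), by rw [post_mk₀, Category.id_comp, elt_apply_one]⟩
    · rw [post_mk₀, Category.id_comp, Ext.mk₀_eq_zero_iff] at hn
      have : (elt n) (1 : R) = (0 : ModuleCat.of R R ⟶ N) (1 : R) := by rw [hn]
      have h : (1 : R) • n = 0 := this
      rw [one_smul] at h
      rw [h]
      exact zero_mem _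

lemma TopClass.quotSMulTop {B : ModuleCat.{0} R} {J : Ideal R} {k : ℕ} (h : TopClass B J k)
    {x : R} (reg : IsSMulRegular B x) :
    TopClass (ModuleCat.of R (QuotSMulTop x B)) (J ⊔ Ideal.span {x}) (k + 1) where
  vanish N i hi y := by
    obtain ⟨i, rfl⟩ := Nat.exists_eq_succ_of_ne_zero (by omega : i ≠ 0)
    obtain ⟨z, rfl⟩ := Ext.contravariant_sequence_exact₃ (shortExact_quotSMulTop B reg) N y
      (h.vanish N _ (by omega) _) (add_comm 1 i)
    rw [h.vanish N i (by omega) z, Ext.comp_zero]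
  gen := by
    obtain ⟨u, hu⟩ := h.gen
    have hS := shortExact_quotSMulTop B reg
    refine ⟨hS.extClass.comp u (add_comm 1 k), fun N => ⟨fun y => ?_, fun n hn => ?_⟩⟩
    · obtain ⟨z, rfl⟩ := Ext.contravariant_sequence_exact₃ hS N y
        (h.vanish N _ (by omega) _) (add_comm 1 k)
      obtain ⟨n, rfl⟩ := (hu N).1 z
      exact ⟨n, (post_comp _ _ _ _).symm⟩
    · rw [post_comp] at hn
      obtain ⟨w, hw⟩ := Ext.contravariant_sequence_exact₁ hS N _ (add_comm 1 k) hn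
      obtain ⟨n', rfl⟩ := (hu N).1 w
      change pre (smulHom x B) N k _ = _ at hw
      rw [pre_smulHom, ← post_smul, ← elt_smul] at hw
      have h1 : post B (elt (n + -(x • n'))) k u = 0 := by
        rw [elt_add, post_add, ← hw, ← post_add, ← elt_add, add_neg_cancel]
        rw [← zero_smul R (0 : N), elt_smul, post_smul, zero_smul]
      have h2 := (hu N).2 _ h1
      have h3 := add_mem (Submodule.smul_mono_left (le_sup_left : J ≤ J ⊔ Ideal.span {x}) h2)
        (Submodule.smul_mem_smul (I := J ⊔ Ideal.span {x})
          (Ideal.mem_sup_right (Ideal.mem_span_singleton_self x))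
          (Submodule.mem_top : n' ∈ (⊤ : Submodule R N)))
      rwa [neg_add_cancel_right] at h3

lemma TopClass.of_linearEquiv {B B' : ModuleCat.{0} R} (e : B ≃ₗ[R] B') {J : Ideal R} {k : ℕ}
    (h : TopClass B J k) : TopClass B' J k where
  vanish N i hi := ext_eq_zero_of_linearEquiv e.symm (h.vanish N i hi)
  gen := by
    obtain ⟨u, hu⟩ := h.gen
    refine ⟨pre e.toModuleIso.inv _ _ u, fun N => ⟨fun y => ?_, fun n hn => (hu N).2 n ?_⟩⟩
    · obtain ⟨n, hn⟩ := (hu N).1 (pre e.toModuleIso.hom _ _ y)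
      refine ⟨n, ?_⟩
      rw [← pre_post, ← hn, pre_pre, Iso.inv_hom_id, pre_id]
    · rw [← pre_post] at hn
      rw [← pre_id (post B (elt n) k u), ← e.toModuleIso.hom_inv_id, ← pre_pre, hn, map_zero]

lemma TopClass.of_isWeaklyRegular (rs : List R) : ∀ {B : ModuleCat.{0} R} {J : Ideal R} {k : ℕ},
    TopClass B J k → IsWeaklyRegular B rs →
    TopClass (ModuleCat.of R (B ⧸ (Ideal.ofList rs • ⊤ : Submodule R B))) (J ⊔ Ideal.ofList rs)
      (k + rs.length) := by
  induction rs with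
  | nil =>
    intro B J k h _
    have h0 : (Ideal.ofList ([] : List R) • ⊤ : Submodule R B) = ⊥ := by
      rw [Ideal.ofList_nil, Submodule.bot_smul]
    have := h.of_linearEquiv (B' := ModuleCat.of R (B ⧸ (Ideal.ofList ([] : List R) • ⊤ : Submodule R B)))
      (Submodule.quotEquivOfEqBot _ h0).symm
    simpa using this
  | cons x rs ih =>
    intro B J k h reg
    rw [isWeaklyRegular_cons_iff] at reg
    have := (ih (h.quotSMulTop reg.1) reg.2).of_linearEquiv
      (B' := ModuleCat.of R (B ⧸ (Ideal.ofList (x :: rs) • ⊤ : Submodule R B)))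
      (Submodule.quotOfListConsSMulTopEquivQuotSMulTopInner B x rs).symm
    rwa [sup_assoc, ← Ideal.ofList_cons, add_right_comm] at this

theorem topClass_ofList {rs : List R} (reg : IsWeaklyRegular R rs) :
    TopClass (Cyc (Ideal.ofList rs)) (Ideal.ofList rs) rs.length := by
  have := (TopClass.of_isWeaklyRegular rs TopClass.base reg).of_linearEquiv
    (B' := Cyc (Ideal.ofList rs)) (Submodule.quotEquivOfEq _ _ (by simp))
  rwa [bot_sup_eq, zero_add] at this

/-- A module killed by a weakly `N`-regular sequence of length `n` has no extensions by `N` in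
degrees below `n`. -/
lemma ext_eq_zero_of_isWeaklyRegular {C : ModuleCat.{0} R} (rs : List R)
    (hC : ∀ r ∈ rs, ∀ a : C, r • a = 0) : ∀ {N : ModuleCat.{0} R}, IsWeaklyRegular N rs →
      ∀ i < rs.length, ∀ x : Ext C N i, x = 0 := by
  induction rs with
  | nil => intro N _ i hi; exact absurd hi (Nat.not_lt_zero i)
  | cons r rs ih =>
    intro N reg i hi x
    rw [isWeaklyRegular_cons_iff] at reg
    have hS := shortExact_quotSMulTop N reg.1
    have hx : post C (smulHom r N) i x = 0 := by
      rw [post_smulHom, smul_ext_eq_zero (hC r (by simp))]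
    cases i with
    | zero =>
      obtain ⟨f, rfl⟩ := (Ext.mk₀_bijective _ _).2 x
      rw [post_mk₀, Ext.mk₀_eq_zero_iff] at hx
      have := hS.mono_f
      have hf : f = 0 := by
        rw [← cancel_mono (smulHom r N), hx, Limits.zero_comp]
      rw [hf]
      exact (Ext.mk₀_eq_zero_iff (0 : C ⟶ N)).2 rfl
    | succ i =>
      obtain ⟨z, rfl⟩ := Ext.covariant_sequence_exact₁ C hS x hx rfl
      rw [ih (fun s hs => hC s (by simp [hs])) (N := ModuleCat.of R (QuotSMulTop r N)) reg.2 i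
        (by simpa using hi) z, Ext.zero_comp]

lemma isWeaklyRegular_of_flat {rs : List R} (reg : IsWeaklyRegular R rs) (F : Type)
    [AddCommGroup F] [Module R F] [Module.Flat R F] : IsWeaklyRegular F rs :=
  ((TensorProduct.lid R F).isWeaklyRegular_congr rs).1 (reg.isWeaklyRegular_rTensor (M₂ := F))

end TopClass

end ExtLC

namespace ExtLC

open Abelian IsLocalRing RingTheory.Sequence

lemma isPrecomplete_of_finite {R : Type} [CommRing R] (J : Ideal R) [IsPrecomplete J R]
    (M : Type) [AddCommGroup M] [Module R M] [Module.Finite R M] : IsPrecomplete J M := by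
  rw [← AdicCompletion.of_surjective_iff]
  intro x
  obtain ⟨y, rfl⟩ := AdicCompletion.ofTensorProduct_surjective_of_finite J M x
  induction y with
  | zero => exact ⟨0, by simp⟩
  | add a b ha hb =>
    obtain ⟨a', ha⟩ := ha
    obtain ⟨b', hb⟩ := hb
    exact ⟨a' + b', by rw [map_add, map_add, ha, hb]⟩
  | tmul r m =>
    obtain ⟨r, rfl⟩ := AdicCompletion.of_surjective (I := J) (M := R) r
    refine ⟨r • m, ?_⟩
    rw [AdicCompletion.ofTensorProduct_tmul, map_smul]
    ext n
    rfl

variable {R : Type} [CommRing R] [IsLocalRing R] {d : ℕ}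

variable (R d) in
/-- Every power of the maximal ideal contains a regular sequence of length `d` generating an
ideal primary to the maximal ideal. -/
def HasParameters : Prop :=
  ∀ t, ∃ rs : List R, rs.length = d ∧ (∀ r ∈ rs, r ∈ maximalIdeal R ^ t) ∧
    IsWeaklyRegular R rs ∧ ∃ s, maximalIdeal R ^ s ≤ Ideal.ofList rs

theorem hasParameters [IsNoetherianRing R] (hd : ringKrullDim R = d) (rs : List R)
    (hrs : ∀ r ∈ rs, r ∈ maximalIdeal R) (reg : IsRegular R rs) (hlen : rs.length = d) :
    HasParameters R d := by
  intro t
  have hlt (J : Ideal R) (hJ : J ≠ ⊤) : J • (⊤ : Submodule R (ModuleCat.of R R)) < ⊤ := by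
    rw [lt_top_iff_ne_top]
    change J • (⊤ : Submodule R R) ≠ ⊤
    rwa [smul_eq_mul, Ideal.mul_top]
  have hm := (maximalIdeal.isMaximal R).ne_top
  have hsupp : Module.support R (R ⧸ maximalIdeal R ^ (t + 1)) =
      PrimeSpectrum.zeroLocus (maximalIdeal R ^ (t + 1) : Ideal R) := by
    rw [Module.support_eq_zeroLocus, Ideal.annihilator_quotient]
  obtain ⟨ss, h1, h2, h3⟩ := ModuleCat.exists_isRegular_of_exists_subsingleton_ext
    (maximalIdeal R ^ (t + 1)) d (ModuleCat.of R R)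
    (hlt _ fun h => hm (by
      rw [eq_top_iff, ← h]
      exact Ideal.pow_le_self (Nat.succ_ne_zero t)))
    (Cyc (maximalIdeal R ^ (t + 1))) hsupp <| by
      rw [← hlen]
      refine ModuleCat.subsingleton_ext_of_exists_isRegular (maximalIdeal R) _ ?_ _ (hlt _ hm) rs
        hrs reg
      rw [← PrimeSpectrum.zeroLocus_pow _ (Nat.succ_ne_zero t)]
      exact hsupp.le
  refine ⟨ss, h1, fun r hr => Ideal.pow_le_pow_right (Nat.le_succ t) (h2 r hr),
    h3.toIsWeaklyRegular, ?_⟩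
  have h4 : Module.supportDim R (R ⧸ Ideal.ofList ss) = 0 := by
    have h5 := ringKrullDim_add_length_eq_ringKrullDim_of_isRegular ss h3
    rw [Module.supportDim_quotient_eq_ringKrullDim]
    rw [hd, h1] at h5
    generalize ringKrullDim (R ⧸ Ideal.ofList ss) = k at *
    induction k with
    | bot => simp at h5
    | coe k =>
      induction k with
      | top => exact absurd h5 (by simp; exact fun h => by cases h)
      | coe k =>
        have : k + d = d := by exact_mod_cast h5
        have : k = 0 := by omega
        subst this
        rfl
  have h5 := support_of_supportDim_eq_zero R _ h4
  rw [Module.support_eq_zeroLocus, Ideal.annihilator_quotient, PrimeSpectrum.zeroLocus_eq_iff] at h5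
  exact Ideal.exists_pow_le_of_le_radical_of_fg (h5 ▸ Ideal.le_radical)
    (IsNoetherian.noetherian _)

lemma exists_topClass (hR : HasParameters R d) (t : ℕ) : ∃ q ≤ maximalIdeal R ^ t, (∃ s, maximalIdeal R ^ s ≤ q) ∧
    TopClass (Cyc q) q d := by
  obtain ⟨rs, rfl, h, reg, hs⟩ := hR t
  exact ⟨_, Ideal.span_le.2 h, hs, topClass_ofList reg⟩

lemma lc_subsingleton_of_flat (hR : HasParameters R d) (F : ModuleCat.{0} R) [Module.Flat R F] {i : ℕ} (hi : i < d) :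
    Subsingleton (LC (maximalIdeal R) i F) := by
  refine subsingleton_of_forall_eq 0 fun x => ?_
  obtain ⟨t, -, y, rfl⟩ := exists_ofCyc_of_le i x 0
  obtain ⟨rs, rfl, h, reg, s, hs⟩ := hR t
  have hq : Ideal.ofList rs ≤ maximalIdeal R ^ t := Ideal.span_le.2 h
  rw [← ofCyc_pre i _ hs hq]
  exact (congrArg _ (ext_eq_zero_of_isWeaklyRegular rs
    (fun r hr => smul_cyc_eq_zero (Ideal.subset_span hr))
    (isWeaklyRegular_of_flat reg F) i hi _)).trans (map_zero _)

end ExtLC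

namespace ExtLC

open Abelian IsLocalRing

section Duality

variable {R : Type} [CommRing R]

/-- Functoriality of local cohomology, as a linear map on homomorphisms. -/
def lcMap (J : Ideal R) (i : ℕ) (N N' : ModuleCat.{0} R) :
    (N →ₗ[R] N') →ₗ[R] LC J i N →ₗ[R] LC J i N' where
  toFun f := ((localCohomology J i).map (ModuleCat.ofHom f)).hom
  map_add' f g := LinearMap.ext fun x => lc_map_add J i (ModuleCat.ofHom f) (ModuleCat.ofHom g) x
  map_smul' r f := LinearMap.ext fun x => lc_map_smul J i r (ModuleCat.ofHom f) x

lemma lcMap_lcMap (J : Ideal R) (i : ℕ) {N N' N'' : ModuleCat.{0} R} (f : N →ₗ[R] N')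
    (g : N' →ₗ[R] N'') (x : LC J i N) :
    lcMap J i N' N'' g (lcMap J i N N' f x) = lcMap J i N N'' (g ∘ₗ f) x :=
  lc_map_comp J i (ModuleCat.ofHom f) (ModuleCat.ofHom g) x

lemma lcMap_elt_add (J : Ideal R) (i : ℕ) {N : ModuleCat.{0} R} (n n' : N) (x) :
    (localCohomology J i).map (elt (n + n')) x =
      (localCohomology J i).map (elt n) x + (localCohomology J i).map (elt n') x := by
  rw [elt_add, lc_map_add]

lemma lcMap_elt_smul (J : Ideal R) (i : ℕ) {N : ModuleCat.{0} R} (r : R) (n : N) (x) :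
    (localCohomology J i).map (elt (r • n)) x = r • (localCohomology J i).map (elt n) x := by
  rw [elt_smul, lc_map_smul]

lemma lcMap_elt_ring (J : Ideal R) (i : ℕ) (r : R) (x : LC J i (ModuleCat.of R R)) :
    (localCohomology J i).map (elt (N := ModuleCat.of R R) r) x = r • x := by
  have : elt (N := ModuleCat.of R R) r = r • 𝟙 _ :=
    ModuleCat.hom_ext (LinearMap.ext_ring (by
      change (1 : R) • r = r • (1 : R)
      simp))
  rw [this, lc_map_smul, CategoryTheory.Functor.map_id]
  rfl

variable [IsLocalRing R] {d : ℕ} {ω : ModuleCat.{0} R}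

/-- Elements of top local cohomology of `R` generating the top local cohomology of every
module. -/
lemma exists_generators (hR : HasParameters R d) : ∃ (q : ℕ → Ideal R)
    (u : ∀ t, Ext (Cyc (q t)) (ModuleCat.of R R) d) (s : ℕ → ℕ)
    (_ : ∀ t, maximalIdeal R ^ (s t) ≤ q t), (∀ t, q t ≤ maximalIdeal R ^ t) ∧
    ∀ t (N : ModuleCat.{0} R), (∀ y : Ext (Cyc (q t)) N d, ∃ n : N, y = post _ (elt n) d (u t)) ∧
      ∀ n : N, post _ (elt n) d (u t) = 0 → n ∈ q t • (⊤ : Submodule R N) := by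
  choose q hq hs h using exists_topClass hR
  choose s hs using hs
  choose u hu using fun t => (h t).gen
  exact ⟨q, u, s, hs, hq, hu⟩

lemma exists_lcMap_elt (hR : HasParameters R d) (N : ModuleCat.{0} R)
    (x : LC (maximalIdeal R) d N) :
    ∃ (n : N) (z : LC (maximalIdeal R) d (ModuleCat.of R R)),
      (localCohomology (maximalIdeal R) d).map (elt n) z = x := by
  obtain ⟨q, u, s, hs, hq, hu⟩ := exists_generators hR
  obtain ⟨t, -, y, rfl⟩ := exists_ofCyc_of_le d x 0
  obtain ⟨n, hn⟩ := (hu t N).1 (pre (quotMap (hq t)) _ _ y)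
  refine ⟨n, ofCyc d (hs t) (u t), ?_⟩
  rw [← ofCyc_post, ← hn, ofCyc_pre]

variable [IsNoetherianRing R]

lemma eq_zero_of_lcMap_elt (hR : HasParameters R d) [Module.Finite R ω]
    (hl : ∀ i < d, Subsingleton (LC (maximalIdeal R) i ω)) (w : ω)
    (hw : ∀ z, (localCohomology (maximalIdeal R) d).map (elt w) z = 0) : w = 0 := by
  obtain ⟨q, u, s, hs, hq, hu⟩ := exists_generators hR
  refine IsHausdorff.haus (I := maximalIdeal R) (M := ω) inferInstance w fun t => ?_
  rw [SModEq.zero]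
  refine Submodule.smul_mono_left (hq t) ((hu t ω).2 w ?_)
  have h1 := hw (ofCyc d (hs t) (u t))
  rw [← ofCyc_post] at h1
  exact (map_eq_zero_iff _ (ofCyc_injective d hl (hs t))).1 h1

lemma exists_lcMap_elt_eq [IsPrecomplete (maximalIdeal R) R] (hR : HasParameters R d)
    [Module.Finite R ω] (hl : ∀ i < d, Subsingleton (LC (maximalIdeal R) i ω))
    (g : LC (maximalIdeal R) d (ModuleCat.of R R) →ₗ[R] LC (maximalIdeal R) d ω) :
    ∃ w : ω, ∀ z, (localCohomology (maximalIdeal R) d).map (elt w) z = g z := by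
  obtain ⟨q, u, s, hs, hq, hu⟩ := exists_generators hR
  set v : ∀ t, LC (maximalIdeal R) d (ModuleCat.of R R) := fun t => ofCyc d (hs t) (u t) with hv
  have hqv : ∀ t (w : ω), w ∈ q t • (⊤ : Submodule R ω) →
      (localCohomology (maximalIdeal R) d).map (elt w) (v t) = 0 := by
    intro t w hw
    induction hw using Submodule.smul_induction_on' with
    | smul r hr n _ =>
      rw [lcMap_elt_smul, ← map_smul, hv, smul_ofCyc_eq_zero d (hs t) _ hr, map_zero]
    | add a _ b _ ha hb => rw [lcMap_elt_add, ha, hb, add_zero]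
  have hvq : ∀ t (w : ω), (localCohomology (maximalIdeal R) d).map (elt w) (v t) = 0 →
      w ∈ q t • (⊤ : Submodule R ω) := by
    intro t w hw
    rw [hv, ← ofCyc_post] at hw
    exact (hu t ω).2 w ((map_eq_zero_iff _ (ofCyc_injective d hl (hs t))).1 hw)
  have hsub : ∀ t (w w' : ω), (localCohomology (maximalIdeal R) d).map (elt w) (v t) =
      (localCohomology (maximalIdeal R) d).map (elt w') (v t) ↔
      w - w' ∈ q t • (⊤ : Submodule R ω) := by
    intro t w w'
    have h : (localCohomology (maximalIdeal R) d).map (elt w) (v t) =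
        (localCohomology (maximalIdeal R) d).map (elt (w - w')) (v t) +
        (localCohomology (maximalIdeal R) d).map (elt w') (v t) := by
      rw [← lcMap_elt_add, sub_add_cancel]
    rw [h, add_eq_right]
    exact ⟨hvq t _, hqv t _⟩
  have hw : ∀ t, ∃ w : ω, (localCohomology (maximalIdeal R) d).map (elt w) (v t) = g (v t) := by
    intro t
    obtain ⟨y, hy⟩ := exists_ofCyc d hl (hs t) (g (v t)) fun r hr => by
      rw [← map_smul, hv, smul_ofCyc_eq_zero d (hs t) _ hr, map_zero]
    obtain ⟨n, rfl⟩ := (hu t ω).1 y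
    exact ⟨n, by rw [← hy, ofCyc_post]⟩
  choose w hw using hw
  have hmul : ∀ t t', s t ≤ t' → ∃ r : R, v t = r • v t' := by
    intro t t' h
    have hle : q t' ≤ q t := (hq t').trans ((Ideal.pow_le_pow_right h).trans (hs t))
    obtain ⟨r, hr⟩ := (hu t' (ModuleCat.of R R)).1 (pre (quotMap hle) _ _ (u t))
    refine ⟨r, ?_⟩
    rw [hv]
    dsimp only
    rw [← ofCyc_pre d (hs t) (hs t') hle, hr, ofCyc_post, lcMap_elt_ring]
  have hwq : ∀ t t', s t ≤ t' → w t - w t' ∈ q t • (⊤ : Submodule R ω) := by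
    intro t t' h
    obtain ⟨r, hr⟩ := hmul t t' h
    rw [← hsub, hw, hr, map_smul, map_smul, hw]
  have := isPrecomplete_of_finite (maximalIdeal R) ω
  obtain ⟨w₀, hw₀⟩ := IsPrecomplete.prec this (f := w) fun {m n} hmn => by
    rw [SModEq.sub_mem]
    have h1 := hwq m (max (s m) (s n)) (le_max_left _ _)
    have h2 := hwq n (max (s m) (s n)) (le_max_right _ _)
    have h3 := sub_mem (Submodule.smul_mono_left (hq m) h1)
      (Submodule.smul_mono_left ((hq n).trans (Ideal.pow_le_pow_right hmn)) h2)
    rwa [sub_sub_sub_cancel_right] at h3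
  refine ⟨w₀, fun z => ?_⟩
  have hw₀' : ∀ t, (localCohomology (maximalIdeal R) d).map (elt w₀) (v t) = g (v t) := by
    intro t
    rw [← hw, eq_comm, hsub]
    have h1 := hwq t (s t) le_rfl
    have h2 := Submodule.smul_mono_left (hs t) (SModEq.sub_mem.1 (hw₀ (s t)))
    simpa using add_mem h1 h2
  obtain ⟨t, -, y, rfl⟩ := exists_ofCyc_of_le d z 0
  obtain ⟨r, hr⟩ := (hu t (ModuleCat.of R R)).1 (pre (quotMap (hq t)) _ _ y)
  have hz : ofCyc d le_rfl y = r • v t := by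
    rw [← ofCyc_pre d _ (hs t) (hq t), hr, ofCyc_post, lcMap_elt_ring]
  rw [hz, map_smul, map_smul, hw₀']

/-- Local duality in degree zero. -/
theorem lcMap_bijective [IsPrecomplete (maximalIdeal R) R] (hR : HasParameters R d)
    [Module.Finite R ω] (hl : ∀ i < d, Subsingleton (LC (maximalIdeal R) i ω))
    (N : ModuleCat.{0} R) : Function.Bijective (lcMap (maximalIdeal R) d N ω) := by
  have key : ∀ w w' : ω, (∀ z, (localCohomology (maximalIdeal R) d).map (elt w) z =
      (localCohomology (maximalIdeal R) d).map (elt w') z) → w = w' := by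
    intro w w' h
    rw [← sub_eq_zero]
    refine eq_zero_of_lcMap_elt hR hl _ fun z => ?_
    have := lcMap_elt_add (maximalIdeal R) d (w - w') w' z
    rw [sub_add_cancel, h] at this
    exact right_eq_add.1 this
  have hcomp : ∀ (f : N →ₗ[R] ω) (n : N) z, (localCohomology (maximalIdeal R) d).map (elt (f n)) z =
      lcMap (maximalIdeal R) d N ω f ((localCohomology (maximalIdeal R) d).map (elt n) z) := by
    intro f n z
    exact (congrArg (fun e => (localCohomology (maximalIdeal R) d).map e z)
      (elt_comp n (ModuleCat.ofHom f))).symm.trans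
      (lc_map_comp _ _ (elt n) (ModuleCat.ofHom f) z).symm
  constructor
  · intro f g hfg
    ext n
    exact key _ _ fun z => by rw [hcomp, hcomp, hfg]
  · intro g
    choose w hw using fun n : N => exists_lcMap_elt_eq hR hl
      (g ∘ₗ ((localCohomology (maximalIdeal R) d).map (elt n)).hom)
    refine ⟨⟨⟨w, fun a b => key _ _ fun z => ?_⟩, fun r a => key _ _ fun z => ?_⟩, ?_⟩
    · rw [lcMap_elt_add, hw, hw, hw]
      change g ((localCohomology (maximalIdeal R) d).map (elt (a + b)) z) = _
      rw [lcMap_elt_add, map_add]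
      rfl
    · rw [RingHom.id_apply, lcMap_elt_smul, hw, hw]
      change g ((localCohomology (maximalIdeal R) d).map (elt (r • a)) z) = _
      rw [lcMap_elt_smul, map_smul]
      rfl
    · ext x
      obtain ⟨n, z, rfl⟩ := exists_lcMap_elt hR N x
      rw [← hcomp]
      exact hw n z

end Duality

end ExtLC

namespace ExtLC

open Abelian IsLocalRing

section HigherDuality

variable {R : Type} [CommRing R]

/-- Splicing with a short exact sequence, as a linear map on `Ext`. -/
def extδ {S : ShortComplex (ModuleCat.{0} R)} (hS : S.ShortExact) (ω : ModuleCat.{0} R) (i : ℕ) :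
    Ext S.X₁ ω i →ₗ[R] Ext S.X₃ ω (i + 1) :=
  Ext.precompOfLinear hS.extClass R ω (add_comm 1 i)

/-- The kernel of the free cover of a module by the free module on its elements. -/
abbrev relations (N : ModuleCat.{0} R) : ModuleCat.{0} R :=
  ModuleCat.of R (LinearMap.ker (Finsupp.linearCombination R (id : N → N)))

/-- The free module on the elements of a module. -/
abbrev freeCover (N : ModuleCat.{0} R) : ModuleCat.{0} R := ModuleCat.of R (N →₀ R)

/-- The presentation of a module by the free module on its elements. -/
abbrev presentation (N : ModuleCat.{0} R) : ShortComplex (ModuleCat.{0} R) :=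
  ShortComplex.mk (X₁ := relations N) (X₂ := freeCover N) (X₃ := N)
    (ModuleCat.ofHom (Submodule.subtype _))
    (ModuleCat.ofHom (Finsupp.linearCombination R (id : N → N)))
    (by ext x; exact x.2)

lemma shortExact_presentation (N : ModuleCat.{0} R) : (presentation N).ShortExact :=
  shortExact_mk (A := relations N) (B := freeCover N) (C := N)
    (ModuleCat.ofHom (Submodule.subtype _))
    (ModuleCat.ofHom (Finsupp.linearCombination R (id : N → N)))
    (Submodule.subtype_injective _) (Finsupp.linearCombination_id_surjective R N)
    (LinearMap.exact_subtype_ker_map _)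

instance projective_freeCover (N : ModuleCat.{0} R) : Projective (freeCover N) :=
  (IsProjective.iff_projective (freeCover N)).1 inferInstance

lemma extδ_surjective (N ω : ModuleCat.{0} R) (i : ℕ) :
    Function.Surjective (extδ (shortExact_presentation N) ω i) := by
  intro y
  obtain ⟨z, hz⟩ := Ext.contravariant_sequence_exact₃ (shortExact_presentation N) ω y
    (Ext.eq_zero_of_projective (P := freeCover N) _) (add_comm 1 i)
  exact ⟨z, hz⟩

lemma extδ_injective (N ω : ModuleCat.{0} R) (i : ℕ) :
    Function.Injective (extδ (shortExact_presentation N) ω (i + 1)) := by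
  rw [injective_iff_map_eq_zero]
  intro x hx
  obtain ⟨w, rfl⟩ := Ext.contravariant_sequence_exact₁ (shortExact_presentation N) ω x
    (add_comm 1 (i + 1)) hx
  rw [Ext.eq_zero_of_projective (P := freeCover N) w, Ext.comp_zero]

lemma extδ_extHom_symm_eq_zero_iff (N ω : ModuleCat.{0} R) (f : relations N →ₗ[R] ω) :
    extδ (shortExact_presentation N) ω 0 ((extHom (relations N) ω).symm f) = 0 ↔
      ∃ h : freeCover N →ₗ[R] ω, h ∘ₗ Submodule.subtype _ = f := by
  have key : (extHom (relations N) ω).symm f = Ext.mk₀ (ModuleCat.ofHom f) := by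
    rw [LinearEquiv.symm_apply_eq, extHom_mk₀]
    rfl
  rw [key]
  constructor
  · intro h
    obtain ⟨w, hw⟩ := Ext.contravariant_sequence_exact₁ (shortExact_presentation N) ω _
      (add_comm 1 0) h
    obtain ⟨g, rfl⟩ := (Ext.mk₀_bijective _ _).2 w
    change pre (presentation N).f ω 0 (Ext.mk₀ g) = _ at hw
    rw [pre_mk₀] at hw
    have := (Ext.mk₀_bijective _ _).1 hw
    exact ⟨g.hom, congrArg ModuleCat.Hom.hom this⟩
  · rintro ⟨h, rfl⟩
    change (shortExact_presentation N).extClass.comp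
      (Ext.mk₀ ((presentation N).f ≫ ModuleCat.ofHom h)) (add_comm 1 0) = 0
    rw [← Ext.mk₀_comp_mk₀, ← Ext.comp_assoc_of_third_deg_zero,
      (shortExact_presentation N).extClass_comp, Ext.zero_comp]

variable [IsLocalRing R] {d : ℕ} {ω : ModuleCat.{0} R}

lemma lcδ_presentation_injective (hR : HasParameters R d) (N : ModuleCat.{0} R) {i : ℕ}
    (hi : i < d) : Function.Injective (lcδ (shortExact_presentation N) (maximalIdeal R) i) := by
  rw [injective_iff_map_eq_zero]
  intro x hx
  obtain ⟨y, rfl⟩ := lc_exact₃ (shortExact_presentation N) _ i x hx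
  have := lc_subsingleton_of_flat hR (freeCover N) hi
  rw [Subsingleton.elim y 0, map_zero]

lemma lcδ_presentation_surjective (hR : HasParameters R d) (N : ModuleCat.{0} R) {i : ℕ}
    (hi : i + 1 < d) :
    Function.Surjective (lcδ (shortExact_presentation N) (maximalIdeal R) i) := by
  intro x
  have := lc_subsingleton_of_flat hR (freeCover N) hi
  exact lc_exact₁ (shortExact_presentation N) _ i x (Subsingleton.elim _ _)

variable [IsNoetherianRing R] [IsPrecomplete (maximalIdeal R) R]

/-- Local duality over a complete Cohen-Macaulay local ring. -/
theorem nonempty_localDuality (hR : HasParameters R d) [Module.Finite R ω]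
    (hl : ∀ i < d, Subsingleton (LC (maximalIdeal R) i ω))
    (hH : Module.Injective R (LC (maximalIdeal R) d ω)) (c : ℕ) :
    ∀ (N : ModuleCat.{0} R) (e : ℕ), e + c = d →
      Nonempty (Ext N ω c ≃ₗ[R] (LC (maximalIdeal R) e N →ₗ[R] LC (maximalIdeal R) d ω)) := by
  induction c with
  | zero =>
    intro N e he
    obtain rfl : e = d := by omega
    exact ⟨extHom N ω ≪≫ₗ LinearEquiv.ofBijective _ (lcMap_bijective hR hl N)⟩
  | succ c ih =>
    intro N e he
    cases c with
    | zero =>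
      obtain rfl : d = e + 1 := by omega
      let ι : relations N →ₗ[R] freeCover N := Submodule.subtype _
      let α : (relations N →ₗ[R] ω) →ₗ[R] Ext N ω 1 :=
        extδ (shortExact_presentation N) ω 0 ∘ₗ (extHom (relations N) ω).symm.toLinearMap
      let δ := lcδ (shortExact_presentation N) (maximalIdeal R) e
      let β : (relations N →ₗ[R] ω) →ₗ[R]
          (LC (maximalIdeal R) e N →ₗ[R] LC (maximalIdeal R) (e + 1) ω) :=
        LinearMap.lcomp R _ δ ∘ₗ lcMap (maximalIdeal R) (e + 1) (relations N) ω
      have hα : Function.Surjective α :=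
        (extδ_surjective N ω 0).comp (extHom (relations N) ω).symm.surjective
      have hβ : Function.Surjective β := by
        intro g
        obtain ⟨g', hg'⟩ := hH.out δ (lcδ_presentation_injective hR N e.lt_succ_self) g
        obtain ⟨f, rfl⟩ := (lcMap_bijective hR hl (relations N)).2 g'
        exact ⟨f, LinearMap.ext hg'⟩
      have hker : LinearMap.ker α = LinearMap.ker β := by
        ext f
        rw [LinearMap.mem_ker, LinearMap.mem_ker]
        refine (extδ_extHom_symm_eq_zero_iff N ω f).trans ⟨?_, fun h => ?_⟩
        · rintro ⟨h, rfl⟩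
          ext x
          change lcMap (maximalIdeal R) (e + 1) (relations N) ω (h ∘ₗ ι) (δ x) = 0
          rw [← lcMap_lcMap]
          exact (congrArg _ (map_lcδ (shortExact_presentation N) _ e x)).trans (map_zero _)
        · let φ := lcMap (maximalIdeal R) (e + 1) (relations N) (freeCover N) ι
          have hle : LinearMap.ker φ ≤
              LinearMap.ker (lcMap (maximalIdeal R) (e + 1) (relations N) ω f) := by
            intro x hx
            obtain ⟨y, rfl⟩ := lc_exact₁ (shortExact_presentation N) _ e x hx
            exact LinearMap.congr_fun h y
          obtain ⟨g, hg⟩ := hH.out ((LinearMap.ker φ).liftQ φ le_rfl)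
            (LinearMap.ker_eq_bot.1 (Submodule.ker_liftQ_eq_bot _ _ _ le_rfl))
            ((LinearMap.ker φ).liftQ _ hle)
          obtain ⟨h', rfl⟩ := (lcMap_bijective hR hl (freeCover N)).2 g
          refine ⟨h', (lcMap_bijective hR hl (relations N)).1 (LinearMap.ext fun x => ?_)⟩
          rw [← lcMap_lcMap]
          exact hg (Submodule.Quotient.mk x)
      exact ⟨(LinearMap.quotKerEquivOfSurjective α hα).symm ≪≫ₗ
        Submodule.quotEquivOfEq _ _ hker ≪≫ₗ LinearMap.quotKerEquivOfSurjective β hβ⟩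
    | succ c =>
      obtain ⟨E⟩ := ih (relations N) (e + 1) (by omega)
      let δ := LinearEquiv.ofBijective (lcδ (shortExact_presentation N) (maximalIdeal R) e)
        ⟨lcδ_presentation_injective hR N (by omega), lcδ_presentation_surjective hR N (by omega)⟩
      exact ⟨(LinearEquiv.ofBijective (extδ (shortExact_presentation N) ω (c + 1))
        ⟨extδ_injective N ω c, extδ_surjective N ω (c + 1)⟩).symm ≪≫ₗ E ≪≫ₗ
          LinearEquiv.congrLeft _ R δ.symm⟩

end HigherDuality

end ExtLC

section Cyclicity

open IsLocalRing

variable {R : Type} [CommRing R]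

lemma LinearMap.mem_smul_top_of_injective {X H : Type} [AddCommGroup X] [Module R X]
    [AddCommGroup H] [Module R H] (hH : Module.Injective R H) {J : Ideal R} (hJ : J.FG)
    (f : X →ₗ[R] H) (hf : ∀ x, (∀ r ∈ J, r • x = 0) → f x = 0) :
    f ∈ J • (⊤ : Submodule R (X →ₗ[R] H)) := by
  obtain ⟨n, a, rfl⟩ := Submodule.fg_iff_exists_fin_generating_family.1 hJ
  let φ : X →ₗ[R] (Fin n → X) := LinearMap.pi fun i => a i • LinearMap.id
  have hle : LinearMap.ker φ ≤ LinearMap.ker f := by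
    intro x hx
    refine hf x fun r hr => ?_
    induction hr using Submodule.span_induction with
    | mem r hr =>
      obtain ⟨i, rfl⟩ := hr
      exact congrFun hx i
    | zero => exact zero_smul R x
    | add r s _ _ hr hs => rw [add_smul, hr, hs, add_zero]
    | smul s r _ hr => rw [smul_assoc, hr, smul_zero]
  obtain ⟨g, hg⟩ := hH.out ((LinearMap.ker φ).liftQ φ le_rfl)
    (LinearMap.ker_eq_bot.1 (Submodule.ker_liftQ_eq_bot _ _ _ le_rfl))
    ((LinearMap.ker φ).liftQ f hle)
  have hfg : f = ∑ i, a i • (g ∘ₗ LinearMap.single R (fun _ => X) i) := by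
    ext x
    refine (hg (Submodule.Quotient.mk x)).symm.trans ?_
    change g (φ x) = _
    rw [LinearMap.sum_apply, ← LinearMap.sum_single_apply (φ := fun _ : Fin n => X) (φ x), map_sum]
    refine Finset.sum_congr rfl fun i _ => ?_
    change g (LinearMap.single R (fun _ => X) i (a i • x)) = _
    rw [map_smul, map_smul]
    rfl
  rw [hfg]
  exact sum_mem fun i _ => Submodule.smul_mem_smul (Submodule.subset_span ⟨i, rfl⟩) trivial

variable {M X H : Type} [AddCommGroup M] [Module R M] [AddCommGroup X] [Module R X]
  [AddCommGroup H] [Module R H]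

lemma isHausdorff_of_linearEquiv_hom {J : Ideal R} (hX : ExtLC.IsTors J X) {D : Type}
    [AddCommGroup D] [Module R D] (Φ : D ≃ₗ[R] (X →ₗ[R] H)) : IsHausdorff J D := by
  have key : ∀ (t : ℕ) (x : X), (∀ r ∈ J ^ t, r • x = 0) →
      ∀ z ∈ J ^ t • (⊤ : Submodule R D), Φ z x = 0 := by
    intro t x hx z hz
    induction hz using Submodule.smul_induction_on' with
    | smul r hr n _ => rw [map_smul, LinearMap.smul_apply, ← map_smul, hx r hr, map_zero]
    | add a _ b _ ha hb => rw [map_add, LinearMap.add_apply, ha, hb, add_zero]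
  refine ⟨fun z hz => ?_⟩
  rw [← Φ.map_eq_zero_iff]
  ext x
  obtain ⟨t, ht⟩ := hX x
  exact key t x ht z (SModEq.zero.1 (hz t))

variable [IsLocalRing R]

/-- The map from the residue field determined by a socle element. -/
def socleHom (x : X) (hx : ∀ r ∈ maximalIdeal R, r • x = 0) : ResidueField R →ₗ[R] X :=
  Submodule.liftQ (maximalIdeal R) (LinearMap.toSpanSingleton R X x) hx

lemma socleHom_one (x : X) (hx : ∀ r ∈ maximalIdeal R, r • x = 0) :
    socleHom x hx 1 = x := one_smul R x

lemma smul_residueField_eq_zero {r : R} (hr : r ∈ maximalIdeal R) (a : ResidueField R) :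
    r • a = 0 := by
  rw [Algebra.smul_def]
  have : algebraMap R (ResidueField R) r = 0 := Ideal.Quotient.eq_zero_iff_mem.2 hr
  rw [this, zero_mul]

instance isSimpleModule_residueField : IsSimpleModule R (ResidueField R) :=
  isSimpleModule_iff_quot_maximal.2
    ⟨maximalIdeal R, maximalIdeal.isMaximal R, ⟨LinearEquiv.refl R _⟩⟩

lemma exists_socle_ne_zero [Nontrivial X] (hX : ExtLC.IsTors (maximalIdeal R) X) :
    ∃ s : ResidueField R →ₗ[R] X, s ≠ 0 := by
  classical
  obtain ⟨x, hx⟩ := exists_ne (0 : X)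
  have h := hX x
  obtain ⟨n, hn⟩ : ∃ n, Nat.find h = n + 1 := by
    refine Nat.exists_eq_succ_of_ne_zero fun h0 => hx ?_
    have := Nat.find_spec h
    rw [h0, pow_zero] at this
    simpa using this 1 (by simp)
  have h1 := Nat.find_min h (m := n) (by omega)
  push Not at h1
  obtain ⟨r, hr, hrx⟩ := h1
  have h2 := Nat.find_spec h
  rw [hn] at h2
  have hs : ∀ a ∈ maximalIdeal R, a • r • x = 0 := fun a ha => by
    rw [← mul_smul]
    exact h2 _ (by rw [pow_succ']; exact Ideal.mul_mem_mul ha hr)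
  exact ⟨socleHom (r • x) hs, fun h0 => hrx ((socleHom_one (r • x) hs).symm.trans (by rw [h0]; rfl))⟩

variable [IsNoetherianRing R] [IsPrecomplete (maximalIdeal R) R]

/-- If the endomorphisms of `M` are dual to the torsion module `X`, then they are given by
multiplications if and only if the socle of `X` is one-dimensional. -/
theorem surjective_algebraMap_end_iff [Nontrivial M] (hH : Module.Injective R H)
    (hX : ExtLC.IsTors (maximalIdeal R) X) (Φ : Module.End R M ≃ₗ[R] (X →ₗ[R] H))
    (ε : (ResidueField R →ₗ[R] H) ≃ₗ[R] ResidueField R) :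
    Function.Surjective (algebraMap R (Module.End R M)) ↔
      Nonempty ((ResidueField R →ₗ[R] X) ≃ₗ[R] ResidueField R) := by
  have hsep := isHausdorff_of_linearEquiv_hom hX Φ
  constructor
  · intro hsurj
    have hcyc : ∀ f : X →ₗ[R] H, ∃ r : R, f = r • Φ 1 := by
      intro f
      obtain ⟨r, hr⟩ := hsurj (Φ.symm f)
      refine ⟨r, ?_⟩
      rw [← map_smul, ← Algebra.algebraMap_eq_smul_one, hr, Φ.apply_symm_apply]
    let θ : (ResidueField R →ₗ[R] X) →ₗ[R] ResidueField R :=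
      ε.toLinearMap ∘ₗ LinearMap.compRight R (Φ 1)
    have hθ : Function.Injective θ := by
      refine (injective_iff_map_eq_zero θ).2 fun s hs => ?_
      have hs1 : Φ 1 ∘ₗ s = 0 := ε.map_eq_zero_iff.1 hs
      by_contra hs0
      obtain ⟨f, hf⟩ := hH.out s (LinearMap.injective_of_ne_zero hs0) (ε.symm 1)
      obtain ⟨r, rfl⟩ := hcyc f
      have h0 : ε.symm 1 = 0 := by
        ext a
        rw [← hf a]
        change r • (Φ 1 ∘ₗ s) a = _
        rw [hs1, LinearMap.zero_apply, smul_zero]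
      exact one_ne_zero (ε.symm.map_eq_zero_iff.1 h0)
    have hX0 : Nontrivial X := by
      by_contra hX0
      rw [not_nontrivial_iff_subsingleton] at hX0
      exact one_ne_zero (Φ.map_eq_zero_iff.1 (Subsingleton.elim (Φ 1) 0))
    obtain ⟨s, hs⟩ := exists_socle_ne_zero hX
    have hθ0 : θ ≠ 0 := fun h => hs (hθ (by rw [h]; rfl))
    exact ⟨LinearEquiv.ofBijective θ ⟨hθ, (LinearMap.surjective_or_eq_zero θ).resolve_right hθ0⟩⟩
  · rintro ⟨e⟩
    let res : Module.End R M →ₗ[R] ResidueField R :=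
      { toFun := fun z => ε (Φ z ∘ₗ e.symm 1)
        map_add' := fun y z => by rw [map_add, LinearMap.add_comp, map_add]
        map_smul' := fun r z => by
          rw [map_smul, LinearMap.smul_comp, map_smul, RingHom.id_apply] }
    have hres : ∀ z, res z = 0 → z ∈ maximalIdeal R • (⊤ : Submodule R (Module.End R M)) := by
      intro z hz
      have hz0 : Φ z ∘ₗ e.symm 1 = 0 := ε.map_eq_zero_iff.1 hz
      have hmem : Φ z ∈ maximalIdeal R • (⊤ : Submodule R (X →ₗ[R] H)) := by
        refine LinearMap.mem_smul_top_of_injective hH (IsNoetherian.noetherian _) _ fun x hx => ?_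
        obtain ⟨r, hr⟩ := residue_surjective (e (socleHom x hx))
        have hsoc : socleHom x hx = r • e.symm 1 := by
          rw [← map_smul, LinearEquiv.eq_symm_apply, ← hr, ← Algebra.algebraMap_eq_smul_one]
          rfl
        rw [← socleHom_one x hx, hsoc, LinearMap.smul_apply, map_smul, ← LinearMap.comp_apply,
          hz0, LinearMap.zero_apply, smul_zero]
      have := Submodule.mem_map_of_mem (f := Φ.symm.toLinearMap) hmem
      rw [Submodule.map_smul''] at this
      simpa using Submodule.smul_mono le_rfl le_top this
    have hone : res 1 ≠ 0 := by
      intro h1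
      have htop : ∀ n : ℕ,
          (⊤ : Submodule R (Module.End R M)) ≤ maximalIdeal R ^ n • (⊤ : Submodule R _) := by
        have h : (⊤ : Submodule R (Module.End R M)) ≤ maximalIdeal R • (⊤ : Submodule R _) := by
          intro z _
          have := Submodule.mem_map_of_mem (f := LinearMap.mulLeft R z) (hres 1 h1)
          rw [Submodule.map_smul''] at this
          simpa using Submodule.smul_mono le_rfl le_top this
        intro n
        induction n with
        | zero => simp
        | succ n ih =>
          rw [pow_succ, mul_smul]
          exact ih.trans (Submodule.smul_mono le_rfl h)
      exact one_ne_zero (hsep.haus (1 : Module.End R M) fun n => SModEq.zero.2 (htop n trivial))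
    refine surjective_of_mkQ_comp_surjective (I := maximalIdeal R)
      (f := Algebra.linearMap R (Module.End R M)) fun y => ?_
    obtain ⟨z, rfl⟩ := Submodule.mkQ_surjective _ y
    obtain ⟨r, hr⟩ := residue_surjective (res z / res 1)
    refine ⟨r, ?_⟩
    refine (Submodule.Quotient.eq _).2 (hres _ ?_)
    have hr' : r • res 1 = res z := by
      rw [Algebra.smul_def, show algebraMap R (ResidueField R) r = res z / res 1 from hr,
        div_mul_cancel₀ _ hone]
    rw [map_sub, Algebra.linearMap_apply, Algebra.algebraMap_eq_smul_one, map_smul, hr', sub_self]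

end Cyclicity

section FiniteGrade

open RingTheory.Sequence

lemma exists_isRegular_of_idealGrade_eq {A : Type} [CommRing A] [Nontrivial A] {J : Ideal A} {c : ℕ}
    (h : idealGrade J = c) :
    ∃ rs : List A, (∀ r ∈ rs, r ∈ J) ∧ IsRegular A rs ∧ rs.length = c := by
  have : Nonempty {c : ℕ∞ | ∃ rs : List A, (∀ r ∈ rs, r ∈ J) ∧
      IsRegular A rs ∧ (rs.length : ℕ∞) = c} := ⟨⟨0, [], by simp, IsRegular.nil A A, by simp⟩⟩
  obtain ⟨rs, hrs, reg, hlen⟩ := ENat.sSup_mem_of_nonempty_of_lt_top (s := {c : ℕ∞ |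
    ∃ rs : List A, (∀ r ∈ rs, r ∈ J) ∧ IsRegular A rs ∧ (rs.length : ℕ∞) = c})
    (by
      change idealGrade J < ⊤
      rw [h]
      exact ENat.natCast_lt_top c)
  refine ⟨rs, hrs, reg, ?_⟩
  have : (rs.length : ℕ∞) = c := hlen.trans h
  exact_mod_cast this

end FiniteGrade

/- `(R, 𝔪, 𝕜)` is a `d`-dimensional complete local Cohen-Macaulay ring (Cohen-Macaulayness
being expressed as `grade 𝔪 = d = dim R`) with canonical module `ω`, `I ⊆ R` is an ideal
with `c = grade I`, and `H^c_I(ω) ≠ 0`. -/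
variable (R : Type) [CommRing R] [IsLocalRing R] [IsNoetherianRing R]
  [IsAdicComplete (IsLocalRing.maximalIdeal R) R]

/-- the natural ring homomorphism
`ρ : R → Hom_R(H^c_I(ω_R), H^c_I(ω_R))` (sending `r` to multiplication by `r`, i.e. the
algebra structure map of the endomorphism algebra) is surjective if and only if the socle
`Hom_R(𝕜, H^{d-c}_𝔪(H^c_I(ω_R)))` is a one-dimensional `𝕜`-vector space (equivalently,
isomorphic to `𝕜` as an `R`-module). -/
theorem statement19 (d : ℕ) (hd : ringKrullDim R = (d : WithBot ℕ∞))
    (hCM : idealGrade (IsLocalRing.maximalIdeal R) = (d : ℕ∞))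
    (ω : ModuleCat R) (hω : IsCanonicalModule R d ω)
    (I : Ideal R) (c : ℕ) (hc : idealGrade I = (c : ℕ∞))
    (hne : ¬ Subsingleton ((localCohomology I c).obj ω)) :
    Function.Surjective
        (algebraMap R (Module.End R ((localCohomology I c).obj ω))) ↔
      Nonempty
        ((IsLocalRing.ResidueField R →ₗ[R]
            ((localCohomology (IsLocalRing.maximalIdeal R) (d - c)).obj
              ((localCohomology I c).obj ω)))
          ≃ₗ[R] IsLocalRing.ResidueField R) := by
  have := hω.1
  have hΩ : ∀ i ≠ d, ∀ x : Abelian.Ext (ExtLC.Cyc (IsLocalRing.maximalIdeal R)) ω i, x = 0 := by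
    intro i hi x
    refine ExtLC.ext_eq_zero_of_linearEquiv
      (B := ModuleCat.of R (IsLocalRing.ResidueField R)) (LinearEquiv.refl R _) (fun y => ?_) x
    have := hω.2.1 i hi
    obtain ⟨z, rfl⟩ := (ExtComparison.extEquiv _ ω i).surjective y
    rw [Subsingleton.elim z 0, map_zero]
  have hl := ExtLC.lc_maximalIdeal_subsingleton hΩ
  have hH := ExtLC.injective_lc hΩ
  obtain ⟨xs, hxs, xreg, xlen⟩ := exists_isRegular_of_idealGrade_eq hCM
  have hR := ExtLC.hasParameters hd xs hxs xreg xlen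
  obtain ⟨rs, hrs, reg, rfl⟩ := exists_isRegular_of_idealGrade_eq hc
  have hI := ExtLC.lc_subsingleton_of_isRegular hd (fun i hi => hΩ i hi.ne) I rs hrs reg
  have hle := ExtLC.length_le_of_isRegular hd rs reg
  have : Nontrivial (ExtLC.LC I rs.length ω) := not_subsingleton_iff_nontrivial.1 hne
  obtain ⟨Ψ⟩ := ExtLC.nonempty_localDuality hR hl hH rs.length
    (ExtLC.LC I rs.length ω) (d - rs.length) (by omega)
  have hk : ExtLC.IsTors (IsLocalRing.maximalIdeal R)
      (ModuleCat.of R (IsLocalRing.ResidueField R)) :=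
    fun a => ⟨1, fun r hr => smul_residueField_eq_zero (by simpa using hr) a⟩
  obtain ⟨ε⟩ := hω.2.2
  exact surjective_algebraMap_end_iff hH (ExtLC.isTors_LC _ _)
    ((LinearEquiv.ofBijective _
      (ExtLC.psi_bijective _ (ExtLC.isTors_LC I rs.length) ω hI)).symm ≪≫ₗ Ψ)
    ((LinearEquiv.ofBijective _ (ExtLC.psi_bijective d hk ω hl)).symm ≪≫ₗ
      (ExtComparison.extEquiv _ ω d).symm ≪≫ₗ ε)
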